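/- There is a constant C depending only on m and K such that for every J ⊆ 𝒥 with |J| ≤ M and every t > 0, with probability at least 1 − e^{−t} (over the Gaussian noise ε), the inequality (ε/σ, f)_n ≤ C [ (r_n + √(t/n)) ‖f‖_n + (r_n² + r_n √(t/n)) Ω̃_gr(f) ] holds simultaneously for all f ∈ F(J). -/

import Mathlib

open MeasureTheory ProbabilityTheory

noncomputable section

namespace Census

/-- Additive representation indexed by `{(j,k) : j ≤ k}`: `main j` is the (univariate)
diagonal component for `(j,j)`, `inter j k` the bivariate component for `j < k`;
all components are `m`-times continuously differentiable. -/
structure AddRepM (p m : ℕ) where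
  main : Fin p → ℝ → ℝ
  inter : Fin p → Fin p → ℝ → ℝ → ℝ
  smooth_main : ∀ j, ContDiff ℝ (m : ℕ∞) (main j)
  smooth_inter : ∀ j k, ContDiff ℝ (m : ℕ∞) (fun q : ℝ × ℝ => inter j k q.1 q.2)

namespace AddRepM
variable {p m : ℕ}

def toFun (R : AddRepM p m) (x : Fin p → ℝ) : ℝ :=
  (∑ j, R.main j (x j)) + ∑ j, ∑ k, if j < k then R.inter j k (x j) (x k) else 0

def Gcount (R : AddRepM p m) : ℕ :=
  Nat.card {j : Fin p // R.main j ≠ 0} +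
    Nat.card {q : Fin p × Fin p // q.1 < q.2 ∧ R.inter q.1 q.2 ≠ 0}

end AddRepM

/-- Mixed partial derivative `∂^{a+b} g / ∂u^a ∂v^b`. -/
def pd (a b : ℕ) (g : ℝ → ℝ → ℝ) (u v : ℝ) : ℝ :=
  iteratedDeriv a (fun t => iteratedDeriv b (g t) v) u

/-- `m`-th order smoothness penalty of a univariate component. -/
def Omega1M (m : ℕ) (h : ℝ → ℝ) : ℝ := ∫ u in (0:ℝ)..1, (iteratedDeriv m h u) ^ 2

/-- `m`-th order smoothness penalty of a bivariate component:
`Σ_{a+b=m} ‖∂^m g/∂u^a ∂v^b‖²_{L²([0,1]²)}`. -/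
def Omega2M (m : ℕ) (g : ℝ → ℝ → ℝ) : ℝ :=
  ∑ a ∈ Finset.range (m + 1),
    ∫ q in (Set.Icc (0:ℝ) 1) ×ˢ (Set.Icc (0:ℝ) 1), (pd a (m - a) g q.1 q.2) ^ 2

def OmegaGrM {p m : ℕ} (R : AddRepM p m) : ℝ :=
  (∑ j, Omega1M m (R.main j)) + ∑ j, ∑ k, if j < k then Omega2M m (R.inter j k) else 0

def OmegaTildeGrM {p m : ℕ} (R : AddRepM p m) : ℝ :=
  (∑ j, Real.sqrt (Omega1M m (R.main j))) +
    ∑ j, ∑ k, if j < k then Real.sqrt (Omega2M m (R.inter j k)) else 0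

def evalVecM {n p m : ℕ} (x : Fin n → Fin p → ℝ) (R : AddRepM p m) : Fin n → ℝ :=
  fun i => R.toFun (x i)

def normSqN {n : ℕ} (v : Fin n → ℝ) : ℝ := (1 / n) * ∑ i, v i ^ 2

def normN {n : ℕ} (v : Fin n → ℝ) : ℝ := Real.sqrt (normSqN v)

def innerN {n : ℕ} (u v : Fin n → ℝ) : ℝ := (1 / n) * ∑ i, u i * v i

def objectiveM {n p m : ℕ} (x : Fin n → Fin p → ℝ) (y : Fin n → ℝ) (lam mu : ℝ)
    (R : AddRepM p m) : ℝ :=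
  normSqN (fun i => y i - evalVecM x R i) + lam * OmegaGrM R + mu * (R.Gcount : ℝ)

def IsMinimizerM {n p m : ℕ} (K : ℕ) (x : Fin n → Fin p → ℝ) (y : Fin n → ℝ)
    (lam mu : ℝ) (Rhat : AddRepM p m) : Prop :=
  Rhat.Gcount ≤ K ∧ ∀ R : AddRepM p m, R.Gcount ≤ K →
    objectiveM x y lam mu Rhat ≤ objectiveM x y lam mu R

/-- Critical rate `rₙ = n^{-m/(2m+2)}`. -/
def rnM (m n : ℕ) : ℝ := (n : ℝ) ^ (-(m : ℝ) / (2 * m + 2))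

def logep (p : ℕ) : ℝ := Real.log (Real.exp 1 * p)

def gaussMeasure (n : ℕ) (σ : ℝ) : Measure (Fin n → ℝ) :=
  Measure.pi fun _ : Fin n => gaussianReal 0 ⟨σ ^ 2, sq_nonneg σ⟩

/-- Membership of a representation's support in the index set `J ⊆ 𝒥`. -/
def SuppIn {p m : ℕ} (R : AddRepM p m) (J : Finset (Fin p × Fin p)) : Prop :=
  (∀ j, R.main j ≠ 0 → (j, j) ∈ J) ∧
    (∀ j k, R.inter j k ≠ (0 : ℝ → ℝ → ℝ) → j < k ∧ (j, k) ∈ J)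

end Census

namespace Census

def du (F : ℝ × ℝ → ℝ) (q : ℝ × ℝ) : ℝ := fderiv ℝ F q (1, 0)
def dv (F : ℝ × ℝ → ℝ) (q : ℝ × ℝ) : ℝ := fderiv ℝ F q (0, 1)

lemma contDiff_du {F : ℝ × ℝ → ℝ} {k : ℕ} (h : ContDiff ℝ ((k + 1 : ℕ) : ℕ∞) F) :
    ContDiff ℝ (k : ℕ∞) (du F) := by
  have := (h.fderiv_right (m := ((k : ℕ∞) : WithTop ℕ∞)) (by norm_cast))
  exact this.clm_apply contDiff_const

lemma contDiff_dv {F : ℝ × ℝ → ℝ} {k : ℕ} (h : ContDiff ℝ ((k + 1 : ℕ) : ℕ∞) F) :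
    ContDiff ℝ (k : ℕ∞) (dv F) := by
  have := (h.fderiv_right (m := ((k : ℕ∞) : WithTop ℕ∞)) (by norm_cast))
  exact this.clm_apply contDiff_const

lemma contDiff_du_iter {F : ℝ × ℝ → ℝ} {k a : ℕ} (h : ContDiff ℝ ((k + a : ℕ) : ℕ∞) F) :
    ContDiff ℝ (k : ℕ∞) (du^[a] F) := by
  induction a generalizing k with
  | zero => simpa using h
  | succ a ih =>
    rw [Function.iterate_succ_apply']
    apply contDiff_du
    apply ih
    convert h using 3
    omega

lemma contDiff_dv_iter {F : ℝ × ℝ → ℝ} {k a : ℕ} (h : ContDiff ℝ ((k + a : ℕ) : ℕ∞) F) :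
    ContDiff ℝ (k : ℕ∞) (dv^[a] F) := by
  induction a generalizing k with
  | zero => simpa using h
  | succ a ih =>
    rw [Function.iterate_succ_apply']
    apply contDiff_dv
    apply ih
    convert h using 3
    omega

lemma dv_du {F : ℝ × ℝ → ℝ} (h : ContDiff ℝ ((2 : ℕ) : ℕ∞) F) : dv (du F) = du (dv F) := by
  ext q
  have hd : Differentiable ℝ (fderiv ℝ F) :=
    (h.fderiv_right (m := 1) (by norm_cast)).differentiable (by norm_num)
  have hs : IsSymmSndFDerivAt ℝ F q := by
    apply (h.contDiffAt).isSymmSndFDerivAt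
    simp
  unfold dv du
  rw [fderiv_clm_apply (hd q) (by fun_prop), fderiv_clm_apply (hd q) (by fun_prop)]
  simpa using hs (0, 1) (1, 0)

lemma dv_du_iter {F : ℝ × ℝ → ℝ} {a : ℕ} (h : ContDiff ℝ ((a + 1 : ℕ) : ℕ∞) F) :
    dv (du^[a] F) = du^[a] (dv F) := by
  induction a with
  | zero => rfl
  | succ a ih =>
    rw [Function.iterate_succ_apply', Function.iterate_succ_apply', dv_du, ih]
    · exact h.of_le (by norm_cast; omega)
    · apply contDiff_du_iter
      convert h using 3
      omega

lemma iterDeriv_du {H : ℝ × ℝ → ℝ} {a : ℕ} (h : ContDiff ℝ (a : ℕ∞) H) (u v : ℝ) :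
    iteratedDeriv a (fun t => H (t, v)) u = (du^[a] H) (u, v) := by
  induction a generalizing u with
  | zero => simp
  | succ a ih =>
    rw [iteratedDeriv_succ, Function.iterate_succ_apply']
    have : iteratedDeriv a (fun t => H (t, v)) = fun u => (du^[a] H) (u, v) := by
      ext u
      exact ih (h.of_le (by norm_cast; omega)) u
    rw [this]
    have hd : DifferentiableAt ℝ (du^[a] H) (u, v) := by
      have : ContDiff ℝ ((1 : ℕ) : ℕ∞) (du^[a] H) :=
        contDiff_du_iter (by convert h using 3; omega)
      exact (this.differentiable (by norm_num)) _
    have h2 : HasDerivAt (fun t : ℝ => (t, v)) ((1 : ℝ), (0 : ℝ)) u :=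
      (hasDerivAt_id u).prodMk (hasDerivAt_const u v)
    exact (hd.hasFDerivAt.comp_hasDerivAt u h2).deriv

lemma iterDeriv_dv {H : ℝ × ℝ → ℝ} {a : ℕ} (h : ContDiff ℝ (a : ℕ∞) H) (u v : ℝ) :
    iteratedDeriv a (fun t => H (u, t)) v = (dv^[a] H) (u, v) := by
  induction a generalizing v with
  | zero => simp
  | succ a ih =>
    rw [iteratedDeriv_succ, Function.iterate_succ_apply']
    have : iteratedDeriv a (fun t => H (u, t)) = fun v => (dv^[a] H) (u, v) := by
      ext v
      exact ih (h.of_le (by norm_cast; omega)) v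
    rw [this]
    have hd : DifferentiableAt ℝ (dv^[a] H) (u, v) := by
      have : ContDiff ℝ ((1 : ℕ) : ℕ∞) (dv^[a] H) :=
        contDiff_dv_iter (by convert h using 3; omega)
      exact (this.differentiable (by norm_num)) _
    have h2 : HasDerivAt (fun t : ℝ => (u, t)) ((0 : ℝ), (1 : ℝ)) v :=
      (hasDerivAt_const v u).prodMk (hasDerivAt_id v)
    exact (hd.hasFDerivAt.comp_hasDerivAt v h2).deriv

lemma pd_eq {g : ℝ → ℝ → ℝ} {a b : ℕ}
    (h : ContDiff ℝ ((a + b : ℕ) : ℕ∞) (fun q : ℝ × ℝ => g q.1 q.2)) (u v : ℝ) :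
    pd a b g u v = (du^[a] (dv^[b] (fun q : ℝ × ℝ => g q.1 q.2))) (u, v) := by
  unfold pd
  rw [← iterDeriv_du (contDiff_dv_iter h)]
  congr 1
  ext t
  rw [← iterDeriv_dv (h.of_le (by norm_cast; omega))]

lemma pd_cont {g : ℝ → ℝ → ℝ} {a b : ℕ}
    (h : ContDiff ℝ ((a + b : ℕ) : ℕ∞) (fun q : ℝ × ℝ => g q.1 q.2)) :
    Continuous (fun q : ℝ × ℝ => pd a b g q.1 q.2) := by
  have : (fun q : ℝ × ℝ => pd a b g q.1 q.2) =
      du^[a] (dv^[b] (fun q : ℝ × ℝ => g q.1 q.2)) := by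
    ext q
    exact pd_eq h _ _
  rw [this]
  have h2 : ContDiff ℝ ((0 : ℕ) : ℕ∞) (du^[a] (dv^[b] (fun q : ℝ × ℝ => g q.1 q.2))) := by
    apply contDiff_du_iter
    apply contDiff_dv_iter
    simpa using h
  exact h2.continuous

/-- coordinate directions -/
def edir (b : Bool) : ℝ × ℝ := if b then (1, 0) else (0, 1)

lemma iterF_dir {G : ℝ × ℝ → ℝ} {k : ℕ} (h : ContDiff ℝ (k : ℕ∞) G) (s : Fin k → Bool) :
    ∃ a b, a + b = k ∧ ∀ z, iteratedFDeriv ℝ k G z (fun i => edir (s i)) =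
      (du^[a] (dv^[b] G)) z := by
  induction k with
  | zero => exact ⟨0, 0, rfl, fun z => by simp⟩
  | succ k ih =>
    obtain ⟨a, b, hab, hz⟩ := ih (h.of_le (by norm_cast; omega)) (fun i => s i.succ)
    have key : ∀ z, iteratedFDeriv ℝ (k + 1) G z (fun i => edir (s i)) =
        fderiv ℝ (du^[a] (dv^[b] G)) z (edir (s 0)) := by
      intro z
      have hd : DifferentiableAt ℝ (iteratedFDeriv ℝ k G) z :=
        h.contDiffAt.differentiableAt_iteratedFDeriv (by norm_cast; omega)
      rw [hd.iteratedFDeriv_succ_apply_left']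
      have : (fun z => iteratedFDeriv ℝ k G z (Fin.tail fun i => edir (s i))) =
        du^[a] (dv^[b] G) := by
        ext z
        exact hz z
      rw [this]
    cases hs : s 0 with
    | true =>
      refine ⟨a + 1, b, by omega, fun z => ?_⟩
      rw [key, hs, Function.iterate_succ_apply']
      rfl
    | false =>
      refine ⟨a, b + 1, by omega, fun z => ?_⟩
      rw [key, hs, Function.iterate_succ_apply' (n := b), ← dv_du_iter]
      · rfl
      · apply contDiff_dv_iter
        convert h using 3
        omega

lemma iterF_expand (k : ℕ) (L : ContinuousMultilinearMap ℝ (fun _ : Fin k => ℝ × ℝ) ℝ)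
    (w : ℝ × ℝ) :
    L (fun _ => w) = ∑ s : Fin k → Bool, (∏ i, if s i then w.1 else w.2) *
      L (fun i => edir (s i)) := by
  have hw : ∀ _i : Fin k, w = ∑ b : Bool, (if b then w.1 else w.2) • edir b := by
    intro _
    ext <;> simp [edir]
  have : L (fun _ => w) = L (fun i => ∑ b : Bool, (if b then w.1 else w.2) • edir b) := by
    congr 1
    ext i <;> simp [edir]
  rw [this, ContinuousMultilinearMap.map_sum]
  refine Finset.sum_congr rfl fun s _ => ?_
  rw [ContinuousMultilinearMap.map_smul_univ]
  simp
end Census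
namespace Census

/-- sum of squared top order derivatives -/
def Gam (m : ℕ) (g : ℝ → ℝ → ℝ) (q : ℝ × ℝ) : ℝ :=
  ∑ a ∈ Finset.range (m + 1), (pd a (m - a) g q.1 q.2) ^ 2

lemma Gam_nonneg (m : ℕ) (g : ℝ → ℝ → ℝ) (q : ℝ × ℝ) : 0 ≤ Gam m g q :=
  Finset.sum_nonneg fun _ _ => sq_nonneg _

lemma Gam_cont {m : ℕ} {g : ℝ → ℝ → ℝ}
    (h : ContDiff ℝ (m : ℕ∞) (fun q : ℝ × ℝ => g q.1 q.2)) : Continuous (Gam m g) := by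
  unfold Gam
  refine continuous_finsetSum _ fun a ha => ?_
  have ha' := Finset.mem_range.1 ha
  exact (pd_cont (a := a) (b := m - a) (by convert h using 3; omega)).pow 2

lemma top_bound {m : ℕ} {g : ℝ → ℝ → ℝ}
    (hg : ContDiff ℝ (m : ℕ∞) (fun q : ℝ × ℝ => g q.1 q.2)) {h : ℝ} (h0 : 0 ≤ h)
    {w : ℝ × ℝ} (h1 : |w.1| ≤ h) (h2 : |w.2| ≤ h) (z : ℝ × ℝ) :
    (iteratedFDeriv ℝ m (fun q : ℝ × ℝ => g q.1 q.2) z (fun _ => w)) ^ 2 ≤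
      4 ^ m * h ^ (2 * m) * Gam m g z := by
  have hb : |iteratedFDeriv ℝ m (fun q : ℝ × ℝ => g q.1 q.2) z (fun _ => w)| ≤
      2 ^ m * (h ^ m * Real.sqrt (Gam m g z)) := by
    rw [iterF_expand]
    refine (Finset.abs_sum_le_sum_abs _ _).trans ?_
    have hc : (2 : ℝ) ^ m * (h ^ m * Real.sqrt (Gam m g z)) =
        ∑ _s : Fin m → Bool, (h ^ m * Real.sqrt (Gam m g z)) := by
      simp
    rw [hc]
    refine Finset.sum_le_sum fun s _ => ?_
    rw [abs_mul]
    gcongr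
    · rw [Finset.abs_prod]
      calc ∏ i, |if s i then w.1 else w.2| ≤ ∏ _i : Fin m, h := by
            refine Finset.prod_le_prod (fun _ _ => abs_nonneg _) fun i _ => ?_
            split_ifs <;> assumption
        _ = h ^ m := by simp
    · obtain ⟨a, b, hab, hz⟩ := iterF_dir hg s
      rw [hz]
      apply Real.abs_le_sqrt
      have : (du^[a] (dv^[b] fun q : ℝ × ℝ => g q.1 q.2)) z = pd a (m - a) g z.1 z.2 := by
        have : m - a = b := by omega
        rw [this, pd_eq (by rw [hab]; exact hg)]
      rw [this]
      unfold Gam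
      exact Finset.single_le_sum (f := fun a => (pd a (m - a) g z.1 z.2) ^ 2)
        (fun _ _ => sq_nonneg _) (Finset.mem_range.2 (by omega))
  calc _ = |iteratedFDeriv ℝ m (fun q : ℝ × ℝ => g q.1 q.2) z (fun _ => w)| ^ 2 := by
        rw [sq_abs]
    _ ≤ (2 ^ m * (h ^ m * Real.sqrt (Gam m g z))) ^ 2 := by gcongr
    _ = _ := by
      rw [mul_pow, mul_pow, Real.sq_sqrt (Gam_nonneg _ _ _), ← pow_mul, ← pow_mul, mul_comm m 2,
        pow_mul 2 2 m]
      norm_num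
      ring

lemma sq_integral_le {φ : ℝ → ℝ} (hφ : Continuous φ) :
    (∫ t in (0:ℝ)..1, φ t) ^ 2 ≤ ∫ t in (0:ℝ)..1, φ t ^ 2 := by
  set c := ∫ t in (0:ℝ)..1, φ t with hc
  have h0 : 0 ≤ ∫ t in (0:ℝ)..1, (φ t - c) ^ 2 :=
    intervalIntegral.integral_nonneg (by norm_num) fun t _ => sq_nonneg _
  have : ∫ t in (0:ℝ)..1, (φ t - c) ^ 2 = (∫ t in (0:ℝ)..1, φ t ^ 2) - 2 * c * c + c ^ 2 := by
    have : ∀ t, (φ t - c) ^ 2 = (φ t ^ 2 - 2 * c * φ t) + c ^ 2 := fun t => by ring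
    simp_rw [this]
    rw [intervalIntegral.integral_add, intervalIntegral.integral_sub,
      intervalIntegral.integral_const_mul, ← hc]
    · simp
    all_goals exact (by fun_prop : Continuous _).intervalIntegrable _ _
  nlinarith

/-- polynomials of coordinate degree `< k` -/
def PS (k : ℕ) : Submodule ℝ (ℝ × ℝ → ℝ) :=
  Submodule.span ℝ (Set.range fun ab : Fin k × Fin k =>
    fun x : ℝ × ℝ => x.1 ^ (ab.1 : ℕ) * x.2 ^ (ab.2 : ℕ))

lemma PS_mono {k l : ℕ} (h : k ≤ l) : PS k ≤ PS l := by
  refine Submodule.span_le.2 ?_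
  rintro _ ⟨⟨a, b⟩, rfl⟩
  exact Submodule.subset_span ⟨(⟨a, by omega⟩, ⟨b, by omega⟩), rfl⟩

lemma mono_mem {k a b : ℕ} (ha : a < k) (hb : b < k) :
    (fun x : ℝ × ℝ => x.1 ^ a * x.2 ^ b) ∈ PS k :=
  Submodule.subset_span ⟨(⟨a, ha⟩, ⟨b, hb⟩), rfl⟩

lemma PS_mul1 {k : ℕ} {f : ℝ × ℝ → ℝ} (hf : f ∈ PS k) (c : ℝ) :
    (fun x => (x.1 - c) * f x) ∈ PS (k + 1) := by
  induction hf using Submodule.span_induction with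
  | mem f hf =>
    obtain ⟨⟨a, b⟩, rfl⟩ := hf
    have h1 := mono_mem (k := k + 1) (a := a + 1) (b := b) (by omega) (by omega)
    have h2 := mono_mem (k := k + 1) (a := a) (b := b) (by omega) (by omega)
    convert (PS (k + 1)).sub_mem h1 ((PS (k + 1)).smul_mem c h2) using 1
    ext x
    simp
    ring
  | zero =>
    convert (PS (k + 1)).zero_mem using 1
    ext x
    simp
  | add f g _ _ h1 h2 =>
    convert (PS (k + 1)).add_mem h1 h2 using 1
    ext x
    simp
    ring
  | smul r f _ h1 =>
    convert (PS (k + 1)).smul_mem r h1 using 1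
    ext x
    simp
    ring

lemma PS_mul2 {k : ℕ} {f : ℝ × ℝ → ℝ} (hf : f ∈ PS k) (c : ℝ) :
    (fun x => (x.2 - c) * f x) ∈ PS (k + 1) := by
  induction hf using Submodule.span_induction with
  | mem f hf =>
    obtain ⟨⟨a, b⟩, rfl⟩ := hf
    have h1 := mono_mem (k := k + 1) (a := a) (b := b + 1) (by omega) (by omega)
    have h2 := mono_mem (k := k + 1) (a := a) (b := b) (by omega) (by omega)
    convert (PS (k + 1)).sub_mem h1 ((PS (k + 1)).smul_mem c h2) using 1
    ext x
    simp
    ring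
  | zero =>
    convert (PS (k + 1)).zero_mem using 1
    ext x
    simp
  | add f g _ _ h1 h2 =>
    convert (PS (k + 1)).add_mem h1 h2 using 1
    ext x
    simp
    ring
  | smul r f _ h1 =>
    convert (PS (k + 1)).smul_mem r h1 using 1
    ext x
    simp
    ring

lemma prod_mem_PS {k : ℕ} (s : Fin k → Bool) (y : ℝ × ℝ) :
    (fun x : ℝ × ℝ => ∏ i, if s i then (x - y).1 else (x - y).2) ∈ PS (k + 1) := by
  induction k with
  | zero => simpa using mono_mem (k := 1) (a := 0) (b := 0) (by omega) (by omega)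
  | succ k ih =>
    simp_rw [Fin.prod_univ_succ]
    cases s 0 with
    | true => exact PS_mul1 (ih _) y.1
    | false => exact PS_mul2 (ih _) y.2

/-- Taylor polynomial -/
def TP (m : ℕ) (G : ℝ × ℝ → ℝ) (y x : ℝ × ℝ) : ℝ :=
  ∑ k ∈ Finset.range m, (k.factorial : ℝ)⁻¹ • (iteratedFDeriv ℝ k G y (fun _ ↦ x - y))

lemma TP_mem (m : ℕ) (G : ℝ × ℝ → ℝ) (y : ℝ × ℝ) : TP m G y ∈ PS m := by
  have : TP m G y = ∑ k ∈ Finset.range m, (k.factorial : ℝ)⁻¹ •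
      ∑ s : Fin k → Bool, (iteratedFDeriv ℝ k G y (fun i => edir (s i))) •
        (fun x : ℝ × ℝ => ∏ i, if s i then (x - y).1 else (x - y).2) := by
    ext x
    unfold TP
    simp only [Finset.sum_apply, Pi.smul_apply]
    refine Finset.sum_congr rfl fun k _ => ?_
    rw [iterF_expand]
    congr 1
    refine Finset.sum_congr rfl fun s _ => ?_
    rw [smul_eq_mul, mul_comm]
  rw [this]
  refine Submodule.sum_mem _ fun k hk => Submodule.smul_mem _ _ <|
    Submodule.sum_mem _ fun s _ => Submodule.smul_mem _ _ ?_
  exact PS_mono (Finset.mem_range.1 hk) (prod_mem_PS s y)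

lemma taylor_bound {m : ℕ} (hm : 2 ≤ m) {g : ℝ → ℝ → ℝ}
    (hg : ContDiff ℝ (m : ℕ∞) (fun q : ℝ × ℝ => g q.1 q.2)) {h : ℝ} (h0 : 0 ≤ h)
    {x y : ℝ × ℝ} (h1 : |(x - y).1| ≤ h) (h2 : |(x - y).2| ≤ h) :
    (g x.1 x.2 - TP m (fun q : ℝ × ℝ => g q.1 q.2) y x) ^ 2 ≤
      ∫ t in (0:ℝ)..1, (1 - t) ^ 2 * (4 ^ m * h ^ (2 * m)) * Gam m g (y + t • (x - y)) := by
  obtain ⟨n, rfl⟩ : ∃ n, m = n + 1 := ⟨m - 1, by omega⟩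
  set G := (fun q : ℝ × ℝ => g q.1 q.2) with hG
  have hgc : ContDiff ℝ ((n : WithTop ℕ∞) + 1) G := by
    have e : ((n : WithTop ℕ∞) + 1) = (((n + 1 : ℕ) : ℕ∞) : WithTop ℕ∞) := by norm_cast
    rw [e]
    exact hg
  have key := map_add_eq_sum_add_integral_iteratedFDeriv (f := G) (x := y) (y := x - y) (n := n)
    (fun t _ => hgc.contDiffAt)
  have hx : g x.1 x.2 = G (y + (x - y)) := by simp [hG]
  have e : g x.1 x.2 - TP (n + 1) G y x = (n.factorial : ℝ)⁻¹ • ∫ t in (0:ℝ)..1, (1 - t)^n •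
      iteratedFDeriv ℝ (n + 1) G (y + t • (x - y)) (fun _ ↦ x - y) := by
    rw [hx, key, TP]
    ring
  have hcont : Continuous fun t : ℝ =>
      iteratedFDeriv ℝ (n + 1) G (y + t • (x - y)) (fun _ ↦ x - y) := by
    have h1 : Continuous (iteratedFDeriv ℝ (n + 1) G) :=
      hg.continuous_iteratedFDeriv (m := n + 1) (by norm_cast)
    have h2 : Continuous fun t : ℝ => iteratedFDeriv ℝ (n + 1) G (y + t • (x - y)) :=
      h1.comp (by fun_prop)
    exact h2.eval_const _
  have hGc := Gam_cont hg
  rw [e, smul_eq_mul, mul_pow]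
  have hf : ((n.factorial : ℝ)⁻¹) ^ 2 ≤ 1 := by
    apply pow_le_one₀ (by positivity)
    apply inv_le_one_of_one_le₀
    exact_mod_cast n.factorial_pos
  refine (mul_le_of_le_one_left (sq_nonneg _) hf).trans ?_
  refine (sq_integral_le (by simp only [smul_eq_mul]; fun_prop)).trans ?_
  apply intervalIntegral.integral_mono_on (by norm_num)
  · apply Continuous.intervalIntegrable
    simp only [smul_eq_mul]; fun_prop
  · apply Continuous.intervalIntegrable
    have : Continuous fun t : ℝ => Gam (n + 1) g (y + t • (x - y)) := hGc.comp (by fun_prop)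
    fun_prop
  · intro t ht
    rw [smul_eq_mul, mul_pow, mul_assoc]
    have hb := top_bound hg h0 h1 h2 (y + t • (x - y))
    have ht1 : 0 ≤ 1 - t := by linarith [ht.2]
    have : ((1 - t) ^ n) ^ 2 ≤ (1 - t) ^ 2 := by
      rw [← pow_mul]
      exact pow_le_pow_of_le_one ht1 (by linarith [ht.1]) (by omega)
    gcongr

end Census
namespace Census
open scoped ENNReal

lemma lint_contract {S : Set (ℝ × ℝ)} (hS : MeasurableSet S) (hc : Convex ℝ S)
    {x : ℝ × ℝ} (hx : x ∈ S) {Φ : ℝ × ℝ → ℝ≥0∞} (hΦ : Measurable Φ) {t : ℝ} (ht0 : 0 ≤ t)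
    (ht1 : t < 1) :
    ∫⁻ y in S, Φ (y + t • (x - y)) ≤ ENNReal.ofReal (((1 - t) ^ 2)⁻¹) * ∫⁻ y in S, Φ y := by
  have hr : (1 - t) ≠ 0 := by linarith
  have hr0 : 0 < 1 - t := by linarith
  have e1 : ∀ y : ℝ × ℝ, y + t • (x - y) = (1 - t) • y + t • x := by
    intro y
    rw [smul_sub, sub_smul, one_smul]
    abel
  simp_rw [e1]
  rw [← lintegral_indicator hS, ← lintegral_indicator hS]
  calc ∫⁻ y, S.indicator (fun y => Φ ((1 - t) • y + t • x)) y
      ≤ ∫⁻ y : ℝ × ℝ, S.indicator Φ ((1 - t) • y + t • x) := by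
        refine lintegral_mono fun y => ?_
        by_cases hy : y ∈ S
        · have : (1 - t) • y + t • x ∈ S := hc hy hx hr0.le ht0 (by ring)
          simp [hy, this]
        · simp [hy]
    _ = ∫⁻ z, S.indicator Φ (z + t • x)
          ∂(Measure.map (fun y : ℝ × ℝ => (1 - t) • y) volume) := by
        rw [lintegral_map]
        · exact (hΦ.indicator hS).comp (by fun_prop)
        · fun_prop
    _ = ENNReal.ofReal (((1 - t) ^ 2)⁻¹) * ∫⁻ z, S.indicator Φ (z + t • x) := by
        have := Measure.map_addHaar_smul (volume : Measure (ℝ × ℝ)) hr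
        rw [this, lintegral_smul_measure]
        congr 2
        simp
    _ = _ := by
        rw [lintegral_add_right_eq_self (fun z => S.indicator Φ z)]

lemma lint_rem {m : ℕ} (hm : 2 ≤ m) {g : ℝ → ℝ → ℝ}
    (hg : ContDiff ℝ (m : ℕ∞) (fun q : ℝ × ℝ => g q.1 q.2)) {h : ℝ} (h0 : 0 ≤ h)
    {S : Set (ℝ × ℝ)} (hS : MeasurableSet S) (hc : Convex ℝ S)
    (hd : ∀ x ∈ S, ∀ y ∈ S, |(x - y).1| ≤ h ∧ |(x - y).2| ≤ h) {x : ℝ × ℝ} (hx : x ∈ S) :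
    ∫⁻ y in S, ENNReal.ofReal ((g x.1 x.2 - TP m (fun q : ℝ × ℝ => g q.1 q.2) y x) ^ 2) ≤
      ENNReal.ofReal (4 ^ m * h ^ (2 * m)) * ∫⁻ y in S, ENNReal.ofReal (Gam m g y) := by
  have hGc := Gam_cont hg
  have hGp : Continuous fun p : (ℝ × ℝ) × ℝ => Gam m g (p.1 + p.2 • (x - p.1)) :=
    hGc.comp (by fun_prop)
  have step1 : ∀ y ∈ S,
      ENNReal.ofReal ((g x.1 x.2 - TP m (fun q : ℝ × ℝ => g q.1 q.2) y x) ^ 2) ≤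
      ∫⁻ t in Set.Ico (0:ℝ) 1, ENNReal.ofReal
        ((1 - t) ^ 2 * (4 ^ m * h ^ (2 * m)) * Gam m g (y + t • (x - y))) := by
    intro y hy
    have hcy : Continuous fun t : ℝ => Gam m g (y + t • (x - y)) := hGc.comp (by fun_prop)
    refine (ENNReal.ofReal_le_ofReal
      (taylor_bound hm hg h0 (hd x hx y hy).1 (hd x hx y hy).2)).trans ?_
    rw [intervalIntegral.integral_of_le (by norm_num), ← integral_Ico_eq_integral_Ioc,
      ofReal_integral_eq_lintegral_ofReal]
    · have : Continuous fun t : ℝ =>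
        (1 - t) ^ 2 * (4 ^ m * h ^ (2 * m)) * Gam m g (y + t • (x - y)) := by fun_prop
      exact (this.continuousOn.integrableOn_Icc (a := 0) (b := 1)).mono_set Set.Ico_subset_Icc_self
    · filter_upwards with t
      have := Gam_nonneg m g (y + t • (x - y))
      positivity
  refine (setLIntegral_mono' hS step1).trans ?_
  rw [lintegral_lintegral_swap]
  · have step2 : ∀ t ∈ Set.Ico (0:ℝ) 1, ∫⁻ y in S, ENNReal.ofReal
        ((1 - t) ^ 2 * (4 ^ m * h ^ (2 * m)) * Gam m g (y + t • (x - y))) ≤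
        ENNReal.ofReal (4 ^ m * h ^ (2 * m)) * ∫⁻ y in S, ENNReal.ofReal (Gam m g y) := by
      intro t ht
      have ht1 : 0 < 1 - t := by linarith [ht.2]
      have e : ∀ y, ENNReal.ofReal
        ((1 - t) ^ 2 * (4 ^ m * h ^ (2 * m)) * Gam m g (y + t • (x - y))) =
        ENNReal.ofReal ((1 - t) ^ 2 * (4 ^ m * h ^ (2 * m))) *
          ENNReal.ofReal (Gam m g (y + t • (x - y))) := fun y =>
        ENNReal.ofReal_mul (by positivity)
      simp_rw [e]
      rw [lintegral_const_mul']
      · have := lint_contract hS hc hx (Φ := fun y => ENNReal.ofReal (Gam m g y))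
          hGc.measurable.ennreal_ofReal ht.1 ht.2
        calc _ ≤ ENNReal.ofReal ((1 - t) ^ 2 * (4 ^ m * h ^ (2 * m))) *
            (ENNReal.ofReal (((1 - t) ^ 2)⁻¹) * ∫⁻ y in S, ENNReal.ofReal (Gam m g y)) := by
              gcongr
          _ = _ := by
            rw [← mul_assoc, ← ENNReal.ofReal_mul (by positivity)]
            congr 2
            field_simp
      · exact ENNReal.ofReal_ne_top
    refine (setLIntegral_mono' measurableSet_Ico step2).trans ?_
    simp
  · apply Measurable.aemeasurable
    apply Measurable.ennreal_ofReal
    apply Continuous.measurable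
    have : Continuous fun p : (ℝ × ℝ) × ℝ => (1 - p.2) ^ 2 * (4 ^ m * h ^ (2 * m)) *
      Gam m g (p.1 + p.2 • (x - p.1)) := by fun_prop
    exact this

lemma TP_cont {m : ℕ} {G : ℝ × ℝ → ℝ} (hG : ContDiff ℝ (m : ℕ∞) G) (x : ℝ × ℝ) :
    Continuous fun y => TP m G y x := by
  unfold TP
  refine continuous_finsetSum _ fun k hk => ?_
  have hk' := Finset.mem_range.1 hk
  have h1 : Continuous (iteratedFDeriv ℝ k G) :=
    hG.continuous_iteratedFDeriv (m := k) (by norm_cast; omega)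
  simp only [smul_eq_mul]
  refine continuous_const.mul ?_
  have h2 : Continuous fun y : ℝ × ℝ => (iteratedFDeriv ℝ k G y, fun _ : Fin k => x - y) := by
    fun_prop
  exact (continuous_eval (F := ContinuousMultilinearMap ℝ (fun _ : Fin k => ℝ × ℝ) ℝ)).comp h2

lemma local_approx {m : ℕ} (hm : 2 ≤ m) {g : ℝ → ℝ → ℝ}
    (hg : ContDiff ℝ (m : ℕ∞) (fun q : ℝ × ℝ => g q.1 q.2)) {h : ℝ} (h0 : 0 < h)
    {S : Set (ℝ × ℝ)} (hS : MeasurableSet S) (hc : Convex ℝ S)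
    (hd : ∀ x ∈ S, ∀ y ∈ S, |(x - y).1| ≤ h ∧ |(x - y).2| ≤ h)
    (hb : S ⊆ Set.Icc (0:ℝ) 1 ×ˢ Set.Icc (0:ℝ) 1)
    (hv : ENNReal.ofReal (h ^ 2) ≤ volume S) {ι : Type*} (I : Finset ι) (z : ι → ℝ × ℝ)
    (hz : ∀ i ∈ I, z i ∈ S) :
    ∃ P ∈ PS m, ∑ i ∈ I, (g (z i).1 (z i).2 - P (z i)) ^ 2 ≤
      I.card * (4 ^ m * h ^ (2 * m - 2)) * ∫ q in S, Gam m g q := by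
  set G := (fun q : ℝ × ℝ => g q.1 q.2) with hG
  have hGc := Gam_cont hg
  have hint : IntegrableOn (Gam m g) S :=
    (hGc.continuousOn.integrableOn_compact (isCompact_Icc.prod isCompact_Icc)).mono_set hb
  set A := ∫ q in S, Gam m g q with hA
  have hA0 : 0 ≤ A := integral_nonneg fun q => Gam_nonneg _ _ _
  have hAl : ∫⁻ y in S, ENNReal.ofReal (Gam m g y) = ENNReal.ofReal A :=
    (ofReal_integral_eq_lintegral_ofReal hint
      (Filter.Eventually.of_forall fun q => Gam_nonneg _ _ _)).symm
  have hS0 : volume S ≠ 0 := by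
    intro h'
    rw [h'] at hv
    have := ENNReal.ofReal_pos.2 (by positivity : 0 < h ^ 2)
    exact absurd hv (not_le.2 this)
  have hSt : volume S ≠ ∞ :=
    ((measure_mono hb).trans_lt (isCompact_Icc.prod isCompact_Icc).measure_lt_top).ne
  obtain ⟨y, hy, hle⟩ := exists_le_setLAverage (μ := volume) (s := S)
    (f := fun y => ∑ i ∈ I, ENNReal.ofReal ((g (z i).1 (z i).2 - TP m G y (z i)) ^ 2)) hS0 hSt
    (by
      apply Measurable.aemeasurable
      refine Finset.measurable_sum _ fun i _ => ?_
      apply Measurable.ennreal_ofReal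
      have := (TP_cont hg (z i)).measurable
      fun_prop)
  refine ⟨TP m G y, TP_mem _ _ _, ?_⟩
  have hsum : ∫⁻ y in S, ∑ i ∈ I, ENNReal.ofReal ((g (z i).1 (z i).2 - TP m G y (z i)) ^ 2) ≤
      ENNReal.ofReal (I.card * (4 ^ m * h ^ (2 * m)) * A) := by
    rw [lintegral_finsetSum' _ (fun i _ => by
      apply Measurable.aemeasurable
      apply Measurable.ennreal_ofReal
      have := (TP_cont hg (z i)).measurable
      fun_prop)]
    calc _ ≤ ∑ i ∈ I, ENNReal.ofReal ((4 ^ m * h ^ (2 * m)) * A) := by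
          refine Finset.sum_le_sum fun i hi => ?_
          rw [ENNReal.ofReal_mul (by positivity), ← hAl]
          exact lint_rem hm hg h0.le hS hc hd (hz i hi)
      _ = _ := by
          rw [Finset.sum_const, nsmul_eq_mul, mul_assoc (I.card : ℝ),
            ENNReal.ofReal_mul (by positivity) (p := (I.card : ℝ)), ENNReal.ofReal_natCast]
  rw [setLAverage_eq] at hle
  rw [← ENNReal.ofReal_sum_of_nonneg (fun i _ => sq_nonneg _)] at hle
  have hle2 : ENNReal.ofReal (∑ i ∈ I, (g (z i).1 (z i).2 - TP m G y (z i)) ^ 2) ≤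
      ENNReal.ofReal (I.card * (4 ^ m * h ^ (2 * m)) * A / h ^ 2) := by
    refine hle.trans ?_
    rw [ENNReal.ofReal_div_of_pos (by positivity)]
    exact ENNReal.div_le_div hsum hv
  rw [ENNReal.ofReal_le_ofReal_iff (by positivity)] at hle2
  refine hle2.trans (le_of_eq ?_)
  have : h ^ (2 * m) = h ^ (2 * m - 2) * h ^ 2 := by
    rw [← pow_add]
    congr 1
    omega
  rw [this]
  field_simp

end Census
namespace Census
open scoped ENNReal

/-- capped dyadic index -/
def idx (l : ℕ) (u : ℝ) : ℕ := min ⌊2 ^ l * u⌋₊ (2 ^ l - 1)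

lemma idx_half (l : ℕ) (u : ℝ) : idx l u = idx (l + 1) u / 2 := by
  have h1 : ⌊2 ^ l * u⌋₊ = ⌊2 ^ (l + 1) * u⌋₊ / 2 := by
    rw [← Nat.floor_div_natCast]
    congr 1
    push_cast
    ring
  have h2 : 0 < 2 ^ l := by positivity
  unfold idx
  rw [h1, pow_succ]
  omega

lemma idx_lt (l : ℕ) (u : ℝ) : idx l u < 2 ^ l := by
  have h2 : 0 < 2 ^ l := by positivity
  unfold idx
  omega

lemma idx_mono (l : ℕ) : Monotone (idx l) := by
  intro u v h
  unfold idx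
  have : ⌊2 ^ l * u⌋₊ ≤ ⌊2 ^ l * v⌋₊ := Nat.floor_le_floor (by gcongr)
  omega

lemma idx_le {l : ℕ} {u : ℝ} (hu : u ∈ Set.Icc (0:ℝ) 1) : (idx l u : ℝ) ≤ 2 ^ l * u := by
  have h1 : idx l u ≤ ⌊2 ^ l * u⌋₊ := min_le_left _ _
  have h2 : (⌊2 ^ l * u⌋₊ : ℝ) ≤ 2 ^ l * u := Nat.floor_le (by have := hu.1; positivity)
  exact le_trans (by exact_mod_cast h1) h2

lemma le_idx {l : ℕ} {u : ℝ} (hu : u ∈ Set.Icc (0:ℝ) 1) : 2 ^ l * u ≤ idx l u + 1 := by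
  have h2 : 0 < 2 ^ l := by positivity
  rcases le_total ⌊2 ^ l * u⌋₊ (2 ^ l - 1) with h | h
  · unfold idx
    rw [min_eq_left h]
    exact (Nat.lt_floor_add_one _).le
  · unfold idx
    rw [min_eq_right h]
    have : ((2 ^ l - 1 : ℕ) : ℝ) + 1 = 2 ^ l := by
      have : 2 ^ l - 1 + 1 = 2 ^ l := by omega
      exact_mod_cast this
    rw [this]
    exact mul_le_of_le_one_right (by positivity) hu.2

lemma idx_eq_of_Ioo {l c : ℕ} {u : ℝ} (hc : c < 2 ^ l) (h1 : (c : ℝ) ≤ 2 ^ l * u)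
    (h2 : 2 ^ l * u < c + 1) : idx l u = c := by
  have : ⌊2 ^ l * u⌋₊ = c := by
    rw [Nat.floor_eq_iff (le_trans (by positivity) h1)]
    exact ⟨h1, h2⟩
  unfold idx
  omega

/-- one dimensional cell -/
def TT (l c : ℕ) : Set ℝ := Set.Icc 0 1 ∩ idx l ⁻¹' {c}

lemma TT_ord (l c : ℕ) : (TT l c).OrdConnected :=
  Set.OrdConnected.inter Set.ordConnected_Icc
    (Set.OrdConnected.preimage_mono Set.ordConnected_singleton (idx_mono l))

lemma TT_diam {l c : ℕ} {u v : ℝ} (hu : u ∈ TT l c) (hv : v ∈ TT l c) :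
    |u - v| ≤ (1 / 2) ^ l := by
  have e1 : idx l u = c := hu.2
  have e2 : idx l v = c := hv.2
  have a1 := idx_le (l := l) hu.1
  have a2 := le_idx (l := l) hu.1
  have b1 := idx_le (l := l) hv.1
  have b2 := le_idx (l := l) hv.1
  rw [e1] at a1 a2
  rw [e2] at b1 b2
  have hp : (0:ℝ) < 2 ^ l := by positivity
  rw [one_div, inv_pow, ← one_div, le_div_iff₀ hp, ← abs_of_pos hp, ← abs_mul, abs_le]
  constructor <;> nlinarith

lemma TT_vol {l c : ℕ} (hc : c < 2 ^ l) : ENNReal.ofReal ((1 / 2) ^ l) ≤ volume (TT l c) := by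
  have hp : (0:ℝ) < 2 ^ l := by positivity
  have hc' : (c : ℝ) + 1 ≤ 2 ^ l := by exact_mod_cast hc
  have hsub : Set.Ioo ((c : ℝ) / 2 ^ l) ((c + 1) / 2 ^ l) ⊆ TT l c := by
    intro u hu
    have h1 := hu.1
    have h2 := hu.2
    rw [div_lt_iff₀ hp] at h1
    rw [lt_div_iff₀ hp] at h2
    refine ⟨⟨?_, ?_⟩, ?_⟩
    · exact le_trans (by positivity) hu.1.le
    · refine hu.2.le.trans ?_
      rw [div_le_one hp]
      exact hc'
    · exact idx_eq_of_Ioo hc (by linarith) (by linarith)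
  refine le_trans (le_of_eq ?_) (measure_mono hsub)
  rw [Real.volume_Ioo]
  congr 1
  rw [one_div, inv_pow]
  field_simp
  ring

def idx2 (l : ℕ) (q : ℝ × ℝ) : ℕ × ℕ := (idx l q.1, idx l q.2)

lemma idx2_mono_eq {l k : ℕ} {q r : ℝ × ℝ} (h : idx2 (l + k) q = idx2 (l + k) r) :
    idx2 l q = idx2 l r := by
  induction k with
  | zero => exact h
  | succ k ih =>
    apply ih
    have h1 : idx (l + k + 1) q.1 = idx (l + k + 1) r.1 := congrArg Prod.fst h
    have h2 : idx (l + k + 1) q.2 = idx (l + k + 1) r.2 := congrArg Prod.snd h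
    unfold idx2
    rw [idx_half (l + k) q.1, idx_half (l + k) q.2, idx_half (l + k) r.1, idx_half (l + k) r.2,
      h1, h2]

/-- two dimensional cell -/
def SS (l : ℕ) (c : ℕ × ℕ) : Set (ℝ × ℝ) := TT l c.1 ×ˢ TT l c.2

lemma mem_SS {l : ℕ} {c : ℕ × ℕ} {q : ℝ × ℝ} :
    q ∈ SS l c ↔ q ∈ Set.Icc (0:ℝ) 1 ×ˢ Set.Icc (0:ℝ) 1 ∧ idx2 l q = c := by
  unfold SS TT idx2
  simp only [Set.mem_prod, Set.mem_inter_iff, Set.mem_preimage, Set.mem_singleton_iff, Prod.ext_iff]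
  tauto

section tree
variable {n : ℕ} (m L : ℕ) (z : Fin n → ℝ × ℝ)

def cnt (l : ℕ) (c : ℕ × ℕ) : ℕ := (Finset.univ.filter fun i => idx2 l (z i) = c).card

def Good (l : ℕ) (q : ℝ × ℝ) : Prop :=
  cnt z l (idx2 l q) * 4 ^ (L * m) ≤ n * 4 ^ (l * (m - 1))

lemma Good_exists (hm : 2 ≤ m) (q : ℝ × ℝ) : Good m L z (L + L) q := by
  unfold Good
  apply Nat.mul_le_mul
  · unfold cnt
    refine (Finset.card_le_univ _).trans ?_
    simp
  · apply Nat.pow_le_pow_right (by norm_num)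
    obtain ⟨k, rfl⟩ : ∃ k, m = k + 2 := ⟨m - 2, by omega⟩
    have : k + 2 - 1 = k + 1 := by omega
    rw [this]
    nlinarith

open Classical in
def lev (q : ℝ × ℝ) : ℕ :=
  if h : ∃ j, Good m L z (L + j) q then Nat.find h else 0

lemma lev_good (hm : 2 ≤ m) (q : ℝ × ℝ) : Good m L z (L + lev m L z q) q := by
  classical
  have h : ∃ j, Good m L z (L + j) q := ⟨L, Good_exists m L z hm q⟩
  unfold lev
  rw [dif_pos h]
  exact Nat.find_spec h

lemma lev_le (hm : 2 ≤ m) {q : ℝ × ℝ} {j : ℕ} (hj : Good m L z (L + j) q) :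
    lev m L z q ≤ j := by
  classical
  have h : ∃ j, Good m L z (L + j) q := ⟨L, Good_exists m L z hm q⟩
  unfold lev
  rw [dif_pos h]
  exact Nat.find_min' h hj

lemma Good_congr {l : ℕ} {q r : ℝ × ℝ} (h : idx2 l q = idx2 l r) (hq : Good m L z l q) :
    Good m L z l r := by
  unfold Good at *
  rwa [← h]

def leaf (q : ℝ × ℝ) : ℕ × ℕ × ℕ := (lev m L z q, idx2 (L + lev m L z q) q)

lemma leaf_eq (hm : 2 ≤ m) {q r : ℝ × ℝ}
    (h : idx2 (L + lev m L z r) q = idx2 (L + lev m L z r) r) :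
    leaf m L z q = leaf m L z r := by
  have h1 : lev m L z q ≤ lev m L z r :=
    lev_le m L z hm (Good_congr m L z h.symm (lev_good m L z hm r))
  have h2 : lev m L z r ≤ lev m L z q := by
    apply lev_le m L z hm
    refine Good_congr m L z ?_ (lev_good m L z hm q)
    apply idx2_mono_eq (k := lev m L z r - lev m L z q)
    have : L + lev m L z q + (lev m L z r - lev m L z q) = L + lev m L z r := by omega
    rw [this]
    exact h
  have h3 := le_antisymm h1 h2
  unfold leaf
  rw [h3, h]

open Classical in
def Bad (j : ℕ) : Finset (ℕ × ℕ) :=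
  (Finset.univ.filter fun i => ¬ Good m L z (L + j) (z i)).image fun i => idx2 (L + j) (z i)

lemma Bad_card (hm : 2 ≤ m) (hn : 1 ≤ n) (j : ℕ) : 4 ^ j * (Bad m L z j).card ≤ 4 ^ L := by
  classical
  have h1 : ∀ c ∈ Bad m L z j, n * 4 ^ ((L + j) * (m - 1)) ≤ cnt z (L + j) c * 4 ^ (L * m) := by
    intro c hc
    unfold Bad at hc
    obtain ⟨i, hi, rfl⟩ := Finset.mem_image.1 hc
    have := (Finset.mem_filter.1 hi).2
    unfold Good at this
    omega
  have h2 : ∑ c ∈ Bad m L z j, cnt z (L + j) c ≤ n := by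
    unfold cnt
    rw [← Finset.card_biUnion]
    · refine (Finset.card_le_univ _).trans ?_
      simp
    · intro a _ b _ hab
      rw [Function.onFun, Finset.disjoint_left]
      intro i hi hi'
      exact hab ((Finset.mem_filter.1 hi).2.symm.trans (Finset.mem_filter.1 hi').2)
  have h3 : (Bad m L z j).card * (n * 4 ^ ((L + j) * (m - 1))) ≤ n * 4 ^ (L * m) := by
    calc _ = ∑ c ∈ Bad m L z j, n * 4 ^ ((L + j) * (m - 1)) := by simp
      _ ≤ ∑ c ∈ Bad m L z j, cnt z (L + j) c * 4 ^ (L * m) := Finset.sum_le_sum h1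
      _ = (∑ c ∈ Bad m L z j, cnt z (L + j) c) * 4 ^ (L * m) := by rw [Finset.sum_mul]
      _ ≤ _ := by gcongr
  obtain ⟨k, rfl⟩ : ∃ k, m = k + 2 := ⟨m - 2, by omega⟩
  have e1 : k + 2 - 1 = k + 1 := by omega
  rw [e1] at h3
  have e2 : 4 ^ ((L + j) * (k + 1)) = 4 ^ j * 4 ^ (j * k) * 4 ^ (L * (k + 1)) := by
    rw [← pow_add, ← pow_add]
    congr 1
    ring
  have e3 : 4 ^ (L * (k + 2)) = 4 ^ L * 4 ^ (L * (k + 1)) := by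
    rw [← pow_add]
    congr 1
    ring
  rw [e2, e3] at h3
  have h4 : (n * 4 ^ (L * (k + 1))) * (4 ^ j * (Bad (k + 2) L z j).card * 4 ^ (j * k)) ≤
      (n * 4 ^ (L * (k + 1))) * 4 ^ L := by
    refine le_trans (le_of_eq ?_) (h3.trans (le_of_eq ?_)) <;> ring
  have h5 := Nat.le_of_mul_le_mul_left h4 (by positivity)
  exact (Nat.le_mul_of_pos_right _ (by positivity)).trans h5

open Classical in
def Leaves : Finset (ℕ × ℕ × ℕ) := Finset.univ.image fun i => leaf m L z (z i)

lemma Leaves_card (hm : 2 ≤ m) (hn : 1 ≤ n) : (Leaves m L z).card ≤ 9 * 4 ^ L := by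
  classical
  have hsub : Leaves m L z ⊆
      ((Finset.range (2 ^ L) ×ˢ Finset.range (2 ^ L)).image fun c => ((0 : ℕ), c)) ∪
      (Finset.range L).biUnion fun j =>
        (Bad m L z j ×ˢ (Finset.range 2 ×ˢ Finset.range 2)).image fun be =>
          (j + 1, 2 * be.1.1 + be.2.1, 2 * be.1.2 + be.2.2) := by
    intro lam hl
    unfold Leaves at hl
    obtain ⟨i, -, rfl⟩ := Finset.mem_image.1 hl
    rw [Finset.mem_union]
    rcases Nat.eq_zero_or_pos (lev m L z (z i)) with h0 | h0
    · left
      refine Finset.mem_image.2 ⟨idx2 L (z i), ?_, ?_⟩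
      · simp [idx2, idx_lt]
      · simp [leaf, h0]
    · right
      obtain ⟨j, hj⟩ : ∃ j, lev m L z (z i) = j + 1 := ⟨lev m L z (z i) - 1, by omega⟩
      have hL := lev_le m L z hm (Good_exists m L z hm (z i))
      refine Finset.mem_biUnion.2 ⟨j, Finset.mem_range.2 (by omega), ?_⟩
      refine Finset.mem_image.2 ⟨(idx2 (L + j) (z i),
        (idx (L + j + 1) (z i).1 % 2, idx (L + j + 1) (z i).2 % 2)), ?_, ?_⟩
      · rw [Finset.mem_product]
        constructor
        · unfold Bad
          refine Finset.mem_image.2 ⟨i, Finset.mem_filter.2 ⟨Finset.mem_univ _, ?_⟩, rfl⟩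
          intro hg
          have := lev_le m L z hm hg
          omega
        · simp only [Finset.mem_product, Finset.mem_range]
          omega
      · have e1 := idx_half (L + j) (z i).1
        have e2 := idx_half (L + j) (z i).2
        unfold leaf
        rw [hj]
        simp only [idx2, Prod.mk.injEq, true_and, ← add_assoc]
        omega
  refine (Finset.card_le_card hsub).trans ?_
  refine (Finset.card_union_le _ _).trans ?_
  have a1 : ((Finset.range (2 ^ L) ×ˢ Finset.range (2 ^ L)).image fun c => ((0 : ℕ), c)).card ≤
      4 ^ L := by
    refine Finset.card_image_le.trans (le_of_eq ?_)
    rw [Finset.card_product, Finset.card_range, ← mul_pow]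
    norm_num
  have a2 : ((Finset.range L).biUnion fun j =>
        (Bad m L z j ×ˢ (Finset.range 2 ×ˢ Finset.range 2)).image fun be =>
          (j + 1, 2 * be.1.1 + be.2.1, 2 * be.1.2 + be.2.2)).card ≤
      ∑ j ∈ Finset.range L, (Bad m L z j).card * 4 := by
    refine Finset.card_biUnion_le.trans (Finset.sum_le_sum fun j _ => ?_)
    refine Finset.card_image_le.trans (le_of_eq ?_)
    simp
  have a3 : ((∑ j ∈ Finset.range L, (Bad m L z j).card : ℕ) : ℝ) ≤ 2 * 4 ^ L := by
    push_cast
    calc ∑ j ∈ Finset.range L, ((Bad m L z j).card : ℝ)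
        ≤ ∑ j ∈ Finset.range L, 4 ^ L * (1 / 4 : ℝ) ^ j := by
          refine Finset.sum_le_sum fun j _ => ?_
          have := Bad_card m L z hm hn j
          have h' : (4:ℝ) ^ j * (Bad m L z j).card ≤ 4 ^ L := by exact_mod_cast this
          rw [one_div, inv_pow, ← div_eq_mul_inv, le_div_iff₀ (by positivity)]
          linarith
      _ = 4 ^ L * ((1 - (1 / 4 : ℝ) ^ L) * (4 / 3)) := by
          rw [← Finset.mul_sum, geom_sum_eq (by norm_num)]
          ring
      _ ≤ _ := by
          have : (0:ℝ) < (1 / 4) ^ L := by positivity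
          have : (0:ℝ) < 4 ^ L := by positivity
          nlinarith
  have a4 : ∑ j ∈ Finset.range L, (Bad m L z j).card ≤ 2 * 4 ^ L := by exact_mod_cast a3
  rw [← Finset.sum_mul] at a2
  omega

end tree
end Census
namespace Census
open scoped ENNReal

lemma SS_meas (l : ℕ) (c : ℕ × ℕ) : MeasurableSet (SS l c) :=
  (TT_ord l c.1).measurableSet.prod (TT_ord l c.2).measurableSet

lemma SS_convex (l : ℕ) (c : ℕ × ℕ) : Convex ℝ (SS l c) :=
  (TT_ord l c.1).convex.prod (TT_ord l c.2).convex

lemma SS_sub (l : ℕ) (c : ℕ × ℕ) : SS l c ⊆ Set.Icc (0:ℝ) 1 ×ˢ Set.Icc (0:ℝ) 1 :=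
  fun _ hq => (mem_SS.1 hq).1

lemma SS_vol {l : ℕ} {c : ℕ × ℕ} (h1 : c.1 < 2 ^ l) (h2 : c.2 < 2 ^ l) :
    ENNReal.ofReal (((1 / 2) ^ l) ^ 2) ≤ volume (SS l c) := by
  unfold SS
  rw [Measure.volume_eq_prod, Measure.prod_prod, sq, ENNReal.ofReal_mul (by positivity)]
  exact mul_le_mul' (TT_vol h1) (TT_vol h2)

lemma Omega2M_eq {m : ℕ} {g : ℝ → ℝ → ℝ}
    (h : ContDiff ℝ (m : ℕ∞) (fun q : ℝ × ℝ => g q.1 q.2)) :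
    Omega2M m g = ∫ q in (Set.Icc (0:ℝ) 1) ×ˢ (Set.Icc (0:ℝ) 1), Gam m g q := by
  unfold Omega2M Gam
  rw [integral_finsetSum]
  intro a ha
  have ha' := Finset.mem_range.1 ha
  have := (pd_cont (g := g) (a := a) (b := m - a) (by convert h using 3; omega)).pow 2
  exact this.continuousOn.integrableOn_compact (isCompact_Icc.prod isCompact_Icc)

open Classical in
/-- restriction of evaluations to the points in one leaf -/
def leafMap {n : ℕ} (m L : ℕ) (z : Fin n → ℝ × ℝ) (lam : ℕ × ℕ × ℕ) :
    (ℝ × ℝ → ℝ) →ₗ[ℝ] (Fin n → ℝ) where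
  toFun f := fun i => if leaf m L z (z i) = lam then f (z i) else 0
  map_add' f g := by
    ext i
    simp only [Pi.add_apply]
    split_ifs <;> simp
  map_smul' c f := by
    ext i
    simp

/-- approximation space -/
def VV {n : ℕ} (m L : ℕ) (z : Fin n → ℝ × ℝ) : Submodule ℝ (Fin n → ℝ) :=
  Submodule.span ℝ (Set.range fun p : Leaves m L z × (Fin m × Fin m) =>
    leafMap m L z p.1 (fun x : ℝ × ℝ => x.1 ^ (p.2.1 : ℕ) * x.2 ^ (p.2.2 : ℕ)))

lemma VV_finrank {n : ℕ} {m : ℕ} (L : ℕ) (z : Fin n → ℝ × ℝ) (hm : 2 ≤ m) (hn : 1 ≤ n) :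
    Module.finrank ℝ (VV m L z) ≤ 9 * m ^ 2 * 4 ^ L := by
  unfold VV
  refine (finrank_range_le_card _).trans ?_
  simp only [Fintype.card_prod, Fintype.card_coe, Fintype.card_fin]
  have := Leaves_card m L z hm hn
  calc (Leaves m L z).card * (m * m) ≤ (9 * 4 ^ L) * (m * m) := by gcongr
    _ = _ := by ring

lemma leafMap_mem {n : ℕ} {m L : ℕ} {z : Fin n → ℝ × ℝ} {lam : ℕ × ℕ × ℕ}
    (hl : lam ∈ Leaves m L z) {P : ℝ × ℝ → ℝ} (hP : P ∈ PS m) :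
    leafMap m L z lam P ∈ VV m L z := by
  have : PS m ≤ (VV m L z).comap (leafMap m L z lam) := by
    refine Submodule.span_le.2 ?_
    rintro _ ⟨ab, rfl⟩
    exact Submodule.subset_span ⟨(⟨lam, hl⟩, ab), rfl⟩
  exact this hP

lemma approx {n m : ℕ} (hm : 2 ≤ m) (L : ℕ) (z : Fin n → ℝ × ℝ)
    (hz : ∀ i, z i ∈ Set.Icc (0:ℝ) 1 ×ˢ Set.Icc (0:ℝ) 1)
    {g : ℝ → ℝ → ℝ} (hg : ContDiff ℝ (m : ℕ∞) (fun q : ℝ × ℝ => g q.1 q.2)) :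
    ∃ v ∈ VV m L z, (∑ i, (g (z i).1 (z i).2 - v i) ^ 2) * 4 ^ (L * m) ≤
      n * 4 ^ m * Omega2M m g := by
  classical
  have hloc : ∀ lam ∈ Leaves m L z, ∃ P ∈ PS m,
      (∑ i ∈ Finset.univ.filter (fun i => leaf m L z (z i) = lam),
        (g (z i).1 (z i).2 - P (z i)) ^ 2) * 4 ^ (L * m) ≤
        n * 4 ^ m * ∫ q in SS (L + lam.1) lam.2, Gam m g q := by
    intro lam hl
    unfold Leaves at hl
    obtain ⟨i0, -, rfl⟩ := Finset.mem_image.1 hl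
    set l := L + lev m L z (z i0) with hldef
    have hleaf : leaf m L z (z i0) = (lev m L z (z i0), idx2 l (z i0)) := rfl
    obtain ⟨P, hP, hb⟩ := local_approx hm hg (h := (1 / 2) ^ l) (by positivity)
      (SS_meas l (idx2 l (z i0))) (SS_convex l (idx2 l (z i0)))
      (fun x hx y hy => ⟨TT_diam hx.1 hy.1, TT_diam hx.2 hy.2⟩) (SS_sub _ _)
      (SS_vol (idx_lt _ _) (idx_lt _ _))
      (Finset.univ.filter (fun i => leaf m L z (z i) = leaf m L z (z i0))) z
      (by
        intro i hi
        have h := (Finset.mem_filter.1 hi).2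
        refine mem_SS.2 ⟨hz i, ?_⟩
        have e1 : lev m L z (z i) = lev m L z (z i0) := congrArg Prod.fst h
        have e2 : idx2 (L + lev m L z (z i)) (z i) = idx2 l (z i0) := congrArg Prod.snd h
        rw [e1] at e2
        exact e2)
    refine ⟨P, hP, ?_⟩
    rw [hleaf] at hb ⊢
    simp only
    rw [← hldef]
    set A := ∫ q in SS l (idx2 l (z i0)), Gam m g q with hA
    have hA0 : 0 ≤ A := integral_nonneg fun q => Gam_nonneg _ _ _
    set N := (Finset.univ.filter (fun i => leaf m L z (z i) =
      (lev m L z (z i0), idx2 l (z i0)))).card with hN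
    have hNc : N ≤ cnt z l (idx2 l (z i0)) := by
      apply Finset.card_le_card
      intro i hi
      have h := (Finset.mem_filter.1 hi).2
      refine Finset.mem_filter.2 ⟨Finset.mem_univ _, ?_⟩
      have e1 : lev m L z (z i) = lev m L z (z i0) := congrArg Prod.fst h
      have e2 : idx2 (L + lev m L z (z i)) (z i) = idx2 l (z i0) := congrArg Prod.snd h
      rw [e1] at e2
      exact e2
    have hgood : cnt z l (idx2 l (z i0)) * 4 ^ (L * m) ≤ n * 4 ^ (l * (m - 1)) :=
      lev_good m L z hm (z i0)
    have hN2 : (N : ℝ) * 4 ^ (L * m) ≤ n * 4 ^ (l * (m - 1)) := by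
      have := (Nat.mul_le_mul_right (4 ^ (L * m)) hNc).trans hgood
      exact_mod_cast this
    have hpow : (((1 : ℝ) / 2) ^ l) ^ (2 * m - 2) * 4 ^ (l * (m - 1)) = 1 := by
      have : 2 * m - 2 = 2 * (m - 1) := by omega
      rw [this, ← pow_mul, ← mul_assoc, mul_comm l 2, mul_assoc, pow_mul, ← mul_pow]
      norm_num
    calc _ ≤ (N * (4 ^ m * ((1 / 2) ^ l) ^ (2 * m - 2)) * A) * 4 ^ (L * m) := by gcongr
      _ = (N * 4 ^ (L * m)) * (4 ^ m * ((1 / 2) ^ l) ^ (2 * m - 2) * A) := by ring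
      _ ≤ (n * 4 ^ (l * (m - 1))) * (4 ^ m * ((1 / 2) ^ l) ^ (2 * m - 2) * A) := by gcongr
      _ = n * 4 ^ m * A * (((1 / 2) ^ l) ^ (2 * m - 2) * 4 ^ (l * (m - 1))) := by ring
      _ = _ := by rw [hpow, mul_one]
  choose! P hP hPb using hloc
  have hmem : ∀ i, leaf m L z (z i) ∈ Leaves m L z := fun i =>
    Finset.mem_image.2 ⟨i, Finset.mem_univ _, rfl⟩
  refine ⟨∑ lam ∈ Leaves m L z, leafMap m L z lam (P lam),
    Submodule.sum_mem _ fun lam hl => leafMap_mem hl (hP lam hl), ?_⟩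
  have hv : ∀ i, (∑ lam ∈ Leaves m L z, leafMap m L z lam (P lam)) i =
      P (leaf m L z (z i)) (z i) := by
    intro i
    rw [Finset.sum_apply]
    simp only [leafMap, LinearMap.coe_mk, AddHom.coe_mk]
    rw [Finset.sum_ite_eq, if_pos (hmem i)]
  simp_rw [hv]
  rw [← Finset.sum_fiberwise_of_maps_to (s := Finset.univ) (t := Leaves m L z)
    (g := fun i => leaf m L z (z i)) (fun i _ => hmem i), Finset.sum_mul]
  have hGc := Gam_cont hg
  have hint : IntegrableOn (Gam m g) (Set.Icc (0:ℝ) 1 ×ˢ Set.Icc (0:ℝ) 1) :=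
    hGc.continuousOn.integrableOn_compact (isCompact_Icc.prod isCompact_Icc)
  calc _ ≤ ∑ lam ∈ Leaves m L z, n * 4 ^ m * ∫ q in SS (L + lam.1) lam.2, Gam m g q := by
        refine Finset.sum_le_sum fun lam hl => ?_
        refine le_trans (le_of_eq ?_) (hPb lam hl)
        congr 1
        refine Finset.sum_congr rfl fun i hi => ?_
        rw [(Finset.mem_filter.1 hi).2]
    _ = n * 4 ^ m * ∫ q in ⋃ lam ∈ Leaves m L z, SS (L + lam.1) lam.2, Gam m g q := by
        rw [← Finset.mul_sum, integral_biUnion_finset]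
        · intro lam _
          exact SS_meas _ _
        · intro a ha b hb hab
          rw [Function.onFun, Set.disjoint_left]
          intro q hq hq'
          apply hab
          unfold Leaves at ha hb
          obtain ⟨i, -, rfl⟩ := Finset.mem_image.1 ha
          obtain ⟨j, -, rfl⟩ := Finset.mem_image.1 hb
          rw [← leaf_eq m L z hm (mem_SS.1 hq).2, ← leaf_eq m L z hm (mem_SS.1 hq').2]
        · intro lam _
          exact hint.mono_set (SS_sub _ _)
    _ ≤ n * 4 ^ m * Omega2M m g := by
        rw [Omega2M_eq hg]
        gcongr
        · filter_upwards with q using Gam_nonneg _ _ _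
        · exact Set.iUnion₂_subset fun lam _ => SS_sub _ _

end Census
namespace Census
open scoped ENNReal

def vv (σ : ℝ) : NNReal := ⟨σ ^ 2, sq_nonneg σ⟩

lemma vv_coe (σ : ℝ) : (vv σ : ℝ) = σ ^ 2 := rfl

lemma vv_one : vv 1 = 1 := by
  ext
  rw [vv_coe]
  simp

lemma gaussMeasure_eq (n : ℕ) (σ : ℝ) :
    gaussMeasure n σ = Measure.pi fun _ : Fin n => gaussianReal 0 (vv σ) := rfl

instance gauss_prob (n : ℕ) (σ : ℝ) : IsProbabilityMeasure (gaussMeasure n σ) := by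
  rw [gaussMeasure_eq]
  infer_instance

lemma exists_onb {n : ℕ} (V : Submodule ℝ (Fin n → ℝ)) :
    ∃ e : Fin (Module.finrank ℝ V) → Fin n → ℝ,
      (∀ a : Fin (Module.finrank ℝ V) → ℝ, ∑ i, (∑ j, a j * e j i) ^ 2 = ∑ j, a j ^ 2) ∧
      ∀ v ∈ V, ∃ a : Fin (Module.finrank ℝ V) → ℝ, ∀ i, v i = ∑ j, a j * e j i := by
  let W : Submodule ℝ (EuclideanSpace ℝ (Fin n)) :=
    V.map (WithLp.linearEquiv 2 ℝ (Fin n → ℝ)).symm.toLinearMap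
  have hr : Module.finrank ℝ W = Module.finrank ℝ V :=
    LinearEquiv.finrank_map_eq (WithLp.linearEquiv 2 ℝ (Fin n → ℝ)).symm V
  let b : OrthonormalBasis (Fin (Module.finrank ℝ V)) ℝ W :=
    (stdOrthonormalBasis ℝ W).reindex (finCongr hr)
  have hco : ∀ (a : Fin (Module.finrank ℝ V) → ℝ) (i : Fin n),
      ((∑ j, a j • b j : W) : EuclideanSpace ℝ (Fin n)) i =
      ∑ j, a j * (b j : EuclideanSpace ℝ (Fin n)) i := by
    intro a i
    simp
  refine ⟨fun j i => (b j : EuclideanSpace ℝ (Fin n)) i, ?_, ?_⟩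
  · intro a
    have h1 : ‖(∑ j, a j • b j : W)‖ ^ 2 = ∑ j, a j ^ 2 := by
      have := b.orthonormal.inner_sum a a Finset.univ
      rw [← real_inner_self_eq_norm_sq, this]
      simp [sq]
    rw [← h1, Submodule.coe_norm, EuclideanSpace.norm_sq_eq]
    refine Finset.sum_congr rfl fun i _ => ?_
    rw [hco, Real.norm_eq_abs, sq_abs]
  · intro v hv
    have hvW : (WithLp.linearEquiv 2 ℝ (Fin n → ℝ)).symm v ∈ W := ⟨v, hv, rfl⟩
    refine ⟨fun j => inner ℝ (b j) ⟨_, hvW⟩, fun i => ?_⟩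
    rw [← hco, b.sum_repr' ⟨_, hvW⟩]
    rfl

lemma gauss_mgf {n : ℕ} {σ : ℝ} (hσ : 0 < σ) (b : Fin n → ℝ) :
    ∫⁻ ε, ENNReal.ofReal (Real.exp (∑ i, b i * (ε i / σ))) ∂(gaussMeasure n σ) =
      ENNReal.ofReal (Real.exp (∑ i, b i ^ 2 / 2)) := by
  have hi : ∀ i, Integrable (fun x : ℝ => Real.exp (b i * (x / σ)))
      (gaussianReal 0 (vv σ)) := by
    intro i
    have := integrable_exp_mul_gaussianReal (μ := 0) (v := vv σ) (b i / σ)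
    convert this using 3
    ring
  have hv : ∀ i, ∫ x : ℝ, Real.exp (b i * (x / σ)) ∂(gaussianReal 0 (vv σ)) =
      Real.exp (b i ^ 2 / 2) := by
    intro i
    have := congrFun (mgf_fun_id_gaussianReal (μ := 0) (v := vv σ)) (b i / σ)
    unfold mgf at this
    have e : ∀ x : ℝ, b i * (x / σ) = b i / σ * x := fun x => by ring
    simp_rw [e]
    rw [this]
    congr 1
    rw [vv_coe]
    field_simp
    ring
  simp_rw [Real.exp_sum]
  rw [← ofReal_integral_eq_lintegral_ofReal]
  · rw [gaussMeasure_eq]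
    rw [integral_fintype_prod_eq_prod (f := fun i x => Real.exp (b i * (x / σ)))]
    simp_rw [hv]
  · exact Integrable.fintype_prod_dep hi
  · filter_upwards with x
    positivity

lemma gauss_sq : ∫ x : ℝ, Real.exp (x ^ 2 / 4) ∂(gaussianReal 0 1) = Real.sqrt 2 := by
  rw [integral_gaussianReal_eq_integral_smul (by norm_num)]
  have : ∀ x : ℝ, gaussianPDFReal 0 1 x • Real.exp (x ^ 2 / 4) =
      (Real.sqrt (2 * Real.pi))⁻¹ * Real.exp (-(1 / 4) * x ^ 2) := by
    intro x
    simp only [gaussianPDFReal, smul_eq_mul, NNReal.coe_one]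
    rw [mul_assoc, ← Real.exp_add]
    ring_nf
  simp_rw [this]
  rw [integral_const_mul, integral_gaussian]
  have hpi := Real.pi_pos
  rw [show Real.pi / (1 / 4) = 2 * (2 * Real.pi) by ring, Real.sqrt_mul (by norm_num : (0:ℝ) ≤ 2) (2 * Real.pi),
    mul_comm, mul_assoc,
    mul_inv_cancel₀ (by positivity), mul_one]

lemma gauss_sq_integrable : Integrable (fun x : ℝ => Real.exp (x ^ 2 / 4)) (gaussianReal 0 1) := by
  by_contra h
  have := integral_undef h
  rw [gauss_sq] at this
  have h2 : (0:ℝ) < Real.sqrt 2 := by positivity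
  linarith

lemma gauss_sq_pi (d : ℕ) :
    ∫⁻ a, ENNReal.ofReal (Real.exp (∑ j, a j ^ 2 / 4)) ∂(gaussMeasure d 1) =
      ENNReal.ofReal (Real.sqrt 2 ^ d) := by
  simp_rw [Real.exp_sum]
  rw [← ofReal_integral_eq_lintegral_ofReal]
  · rw [gaussMeasure_eq]
    rw [integral_fintype_prod_eq_prod (f := fun _ x => Real.exp (x ^ 2 / 4)), vv_one, gauss_sq]
    simp
  · rw [gaussMeasure_eq]
    rw [vv_one]
    exact Integrable.fintype_prod_dep (fun _ => gauss_sq_integrable)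
  · filter_upwards with x
    positivity

lemma chi_mgf {n d : ℕ} {σ : ℝ} (hσ : 0 < σ) (e : Fin d → Fin n → ℝ)
    (he : ∀ a : Fin d → ℝ, ∑ i, (∑ j, a j * e j i) ^ 2 = ∑ j, a j ^ 2) :
    ∫⁻ ε, ENNReal.ofReal (Real.exp (∑ j, (∑ i, e j i * (ε i / σ)) ^ 2 / 4))
      ∂(gaussMeasure n σ) = ENNReal.ofReal (Real.sqrt 2 ^ d) := by
  have s2 : Real.sqrt 2 ^ 2 = 2 := Real.sq_sqrt (by norm_num)
  have s2' : Real.sqrt 2 ≠ 0 := by positivity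
  calc _ = ∫⁻ ε, ∫⁻ a, ENNReal.ofReal (Real.exp
        (∑ j, ((∑ i, e j i * (ε i / σ)) / Real.sqrt 2) * (a j / 1))) ∂(gaussMeasure d 1)
        ∂(gaussMeasure n σ) := by
        refine lintegral_congr fun ε => ?_
        rw [gauss_mgf one_pos]
        congr 3
        ext j
        rw [div_pow, s2]
        ring
    _ = ∫⁻ a, ∫⁻ ε, ENNReal.ofReal (Real.exp
        (∑ j, ((∑ i, e j i * (ε i / σ)) / Real.sqrt 2) * (a j / 1))) ∂(gaussMeasure n σ)
        ∂(gaussMeasure d 1) := by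
        apply lintegral_lintegral_swap
        apply Measurable.aemeasurable
        apply Measurable.ennreal_ofReal
        apply Continuous.measurable
        fun_prop
    _ = ∫⁻ a, ENNReal.ofReal (Real.exp (∑ j, a j ^ 2 / 4)) ∂(gaussMeasure d 1) := by
        refine lintegral_congr fun a => ?_
        have e1 : ∀ ε : Fin n → ℝ, ∑ j, ((∑ i, e j i * (ε i / σ)) / Real.sqrt 2) * (a j / 1) =
            ∑ i, ((∑ j, a j * e j i) / Real.sqrt 2) * (ε i / σ) := by
          intro ε
          simp_rw [Finset.sum_div, Finset.sum_mul]
          rw [Finset.sum_comm]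
          refine Finset.sum_congr rfl fun i _ => Finset.sum_congr rfl fun j _ => ?_
          ring
        simp_rw [e1]
        rw [gauss_mgf hσ]
        congr 2
        rw [← Finset.sum_div, ← Finset.sum_div, ← he a]
        simp_rw [div_pow, s2]
        rw [← Finset.sum_div]
        ring
    _ = _ := gauss_sq_pi d

lemma subspace_tail {n : ℕ} {σ : ℝ} (hσ : 0 < σ) (V : Submodule ℝ (Fin n → ℝ)) {D s : ℝ}
    (hD : (Module.finrank ℝ V : ℝ) ≤ D) (hs : 0 ≤ s) :
    gaussMeasure n σ {ε | ¬ ∀ v ∈ V, ∑ i, (ε i / σ) * v i ≤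
      Real.sqrt (2 * D + 4 * s) * Real.sqrt (∑ i, v i ^ 2)} ≤ ENNReal.ofReal (Real.exp (-s)) := by
  obtain ⟨e, he, hV⟩ := exists_onb V
  set X : (Fin n → ℝ) → ℝ := fun ε => ∑ j, (∑ i, e j i * (ε i / σ)) ^ 2 with hX
  have hsub : {ε : Fin n → ℝ | ¬ ∀ v ∈ V, ∑ i, (ε i / σ) * v i ≤
      Real.sqrt (2 * D + 4 * s) * Real.sqrt (∑ i, v i ^ 2)} ⊆
      {ε | ENNReal.ofReal (Real.exp (D / 2 + s)) ≤
        ENNReal.ofReal (Real.exp (∑ j, (∑ i, e j i * (ε i / σ)) ^ 2 / 4))} := by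
    intro ε hε
    by_contra hcon
    apply hε
    intro v hv
    obtain ⟨a, ha⟩ := hV v hv
    have hlt : X ε ≤ 2 * D + 4 * s := by
      have h1 : ¬ (Real.exp (D / 2 + s) ≤
          Real.exp (∑ j, (∑ i, e j i * (ε i / σ)) ^ 2 / 4)) := fun h =>
        hcon (ENNReal.ofReal_le_ofReal h)
      rw [Real.exp_le_exp, ← Finset.sum_div, not_le] at h1
      simp only [hX]
      linarith
    have h2 : ∑ i, v i ^ 2 = ∑ j, a j ^ 2 := by
      rw [← he a]
      exact Finset.sum_congr rfl fun i _ => by rw [ha]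
    have h3 : ∑ i, (ε i / σ) * v i = ∑ j, a j * ∑ i, e j i * (ε i / σ) := by
      simp_rw [ha, Finset.mul_sum]
      rw [Finset.sum_comm]
      refine Finset.sum_congr rfl fun i _ => Finset.sum_congr rfl fun j _ => ?_
      ring
    rw [h2, h3]
    refine (Real.sum_mul_le_sqrt_mul_sqrt _ _ _).trans ?_
    rw [mul_comm]
    gcongr
  refine (measure_mono hsub).trans ?_
  have hpos : (0:ℝ) < Real.exp (D / 2 + s) := Real.exp_pos _
  refine (meas_ge_le_lintegral_div ?_ (by positivity) ENNReal.ofReal_ne_top).trans ?_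
  · apply Measurable.aemeasurable
    apply Measurable.ennreal_ofReal
    apply Continuous.measurable
    fun_prop
  rw [chi_mgf hσ e he, ← ENNReal.ofReal_div_of_pos hpos]
  apply ENNReal.ofReal_le_ofReal
  rw [div_le_iff₀ hpos, ← Real.exp_add]
  have h2 : Real.sqrt 2 ≤ Real.exp (1 / 2) := by
    rw [Real.sqrt_le_left (Real.exp_pos _).le, ← Real.exp_nat_mul]
    have := Real.add_one_le_exp (1:ℝ)
    norm_num at this ⊢
    linarith
  calc Real.sqrt 2 ^ (Module.finrank ℝ V) ≤ Real.exp (1 / 2) ^ (Module.finrank ℝ V) := by gcongr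
    _ = Real.exp ((Module.finrank ℝ V : ℝ) * (1 / 2)) := by rw [← Real.exp_nat_mul]
    _ ≤ _ := by
      rw [Real.exp_le_exp]
      linarith

end Census
namespace Census

/-- Component of a representation attached to a pair, seen as a bivariate function. -/
def gq {p m : ℕ} (R : AddRepM p m) (q : Fin p × Fin p) : ℝ → ℝ → ℝ :=
  if q.1 = q.2 then fun u _ => R.main q.1 u
  else if q.1 < q.2 then R.inter q.1 q.2 else fun _ _ => 0

lemma gq_smooth {p m : ℕ} (R : AddRepM p m) (q : Fin p × Fin p) :
    ContDiff ℝ (m : ℕ∞) (fun z : ℝ × ℝ => gq R q z.1 z.2) := by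
  unfold gq
  split_ifs
  · exact (R.smooth_main q.1).comp contDiff_fst
  · exact R.smooth_inter q.1 q.2
  · exact contDiff_const

lemma Omega2M_uni (m : ℕ) (h : ℝ → ℝ) : Omega2M m (fun u _ => h u) = Omega1M m h := by
  unfold Omega2M Omega1M
  rw [Finset.sum_range_succ, Finset.sum_eq_zero, zero_add]
  · have e : ∀ q : ℝ × ℝ, (pd m (m - m) (fun u _ => h u) q.1 q.2) ^ 2 =
        (iteratedDeriv m h q.1) ^ 2 * 1 := by
      intro q
      simp [pd]
    simp_rw [e]
    have := setIntegral_prod_mul (μ := (volume : Measure ℝ)) (ν := (volume : Measure ℝ))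
      (fun u => (iteratedDeriv m h u) ^ 2) (fun _ : ℝ => (1:ℝ)) (Set.Icc 0 1) (Set.Icc 0 1)
    rw [Measure.volume_eq_prod, this, intervalIntegral.integral_of_le zero_le_one,
      integral_Icc_eq_integral_Ioc]
    simp
  · intro a ha
    rw [Finset.mem_range] at ha
    have e : ∀ q : ℝ × ℝ, (pd a (m - a) (fun u _ => h u) q.1 q.2) ^ 2 = 0 := by
      intro q
      have h0 : m - a ≠ 0 := by omega
      simp [pd, iteratedDeriv_const, h0]
    simp_rw [e]
    simp

lemma Omega2M_zero (m : ℕ) : Omega2M m (fun _ _ => 0) = 0 := by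
  rw [Omega2M_uni m (fun _ => 0)]
  simp [Omega1M]

lemma Omega2M_nonneg (m : ℕ) (g : ℝ → ℝ → ℝ) : 0 ≤ Omega2M m g :=
  Finset.sum_nonneg fun _ _ => integral_nonneg fun _ => sq_nonneg _

lemma gq_out {p m : ℕ} {R : AddRepM p m} {J : Finset (Fin p × Fin p)} (hR : SuppIn R J)
    {q : Fin p × Fin p} (hq : q ∉ J) : gq R q = fun _ _ => 0 := by
  obtain ⟨j, k⟩ := q
  unfold gq
  split_ifs with h1 h2
  · dsimp only at h1
    subst h1
    have : R.main j = 0 := by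
      by_contra h
      exact hq (hR.1 j h)
    simp [this]
  · have : R.inter j k = 0 := by
      by_contra h
      exact hq (hR.2 j k h).2
    simp only [this]
    rfl
  · rfl

lemma toFun_eq {p m : ℕ} {R : AddRepM p m} {J : Finset (Fin p × Fin p)} (hR : SuppIn R J)
    (y : Fin p → ℝ) : R.toFun y = ∑ q ∈ J, gq R q (y q.1) (y q.2) := by
  rw [Finset.sum_subset (Finset.subset_univ J)
    (fun q _ hq => by rw [gq_out hR hq]), Fintype.sum_prod_type]
  have e : ∀ j k : Fin p, gq R (j, k) (y j) (y k) = (if j = k then R.main j (y j) else 0) +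
      (if j < k then R.inter j k (y j) (y k) else 0) := by
    intro j k
    unfold gq
    by_cases h1 : j = k
    · subst h1
      simp
    · by_cases h2 : j < k <;> simp [h1, h2]
  simp_rw [e, Finset.sum_add_distrib]
  simp [AddRepM.toFun]

lemma OmegaT_eq {p m : ℕ} {R : AddRepM p m} {J : Finset (Fin p × Fin p)} (hR : SuppIn R J) :
    OmegaTildeGrM R = ∑ q ∈ J, Real.sqrt (Omega2M m (gq R q)) := by
  rw [Finset.sum_subset (Finset.subset_univ J)
    (fun q _ hq => by rw [gq_out hR hq, Omega2M_zero, Real.sqrt_zero]), Fintype.sum_prod_type]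
  have e : ∀ j k : Fin p, Real.sqrt (Omega2M m (gq R (j, k))) =
      (if j = k then Real.sqrt (Omega1M m (R.main j)) else 0) +
      (if j < k then Real.sqrt (Omega2M m (R.inter j k)) else 0) := by
    intro j k
    unfold gq
    by_cases h1 : j = k
    · subst h1
      simp [Omega2M_uni]
    · by_cases h2 : j < k <;> simp [h1, h2, Omega2M_zero]
  simp_rw [e, Finset.sum_add_distrib]
  simp [OmegaTildeGrM]

/-- Unnormalized Euclidean norm. -/
def nE {n : ℕ} (v : Fin n → ℝ) : ℝ := Real.sqrt (∑ i, v i ^ 2)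

lemma nE_eq {n : ℕ} (v : Fin n → ℝ) : nE v = ‖WithLp.toLp 2 v‖ := by
  rw [EuclideanSpace.norm_eq]
  simp [nE]

lemma nE_add {n : ℕ} (u v : Fin n → ℝ) : nE (u + v) ≤ nE u + nE v := by
  simp only [nE_eq, WithLp.toLp_add]
  exact norm_add_le _ _

lemma nE_neg {n : ℕ} (u : Fin n → ℝ) : nE (-u) = nE u := by
  simp [nE]

lemma nE_sum {n : ℕ} {ι : Type*} (s : Finset ι) (u : ι → Fin n → ℝ) :
    nE (∑ q ∈ s, u q) ≤ ∑ q ∈ s, nE (u q) := by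
  classical
  induction s using Finset.induction_on with
  | empty => simp [nE]
  | insert a s ha ih =>
    rw [Finset.sum_insert ha, Finset.sum_insert ha]
    exact (nE_add _ _).trans (by gcongr)

lemma nE_nonneg {n : ℕ} (v : Fin n → ℝ) : 0 ≤ nE v := Real.sqrt_nonneg _

lemma normN_eq {n : ℕ} (v : Fin n → ℝ) : normN v = nE v / Real.sqrt n := by
  unfold normN normSqN nE
  rw [one_div_mul_eq_div, Real.sqrt_div' _ (Nat.cast_nonneg n)]

lemma finrank_sup_le {n : ℕ} {ι : Type*} (s : Finset ι) (V : ι → Submodule ℝ (Fin n → ℝ)) :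
    Module.finrank ℝ (s.sup V : Submodule ℝ (Fin n → ℝ)) ≤ ∑ q ∈ s, Module.finrank ℝ (V q) := by
  classical
  induction s using Finset.induction_on with
  | empty => simp
  | insert a s ha ih =>
    rw [Finset.sum_insert ha, Finset.sup_insert]
    exact (Submodule.finrank_add_le_finrank_add_finrank _ _).trans (by gcongr)

lemma mem_fsup {n : ℕ} {ι : Type*} (s : Finset ι) (V : ι → Submodule ℝ (Fin n → ℝ)) {q : ι}
    (hq : q ∈ s) {v : Fin n → ℝ} (hv : v ∈ V q) : v ∈ s.sup V :=
  (Finset.le_sup (f := V) hq) hv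

lemma approx_one {n m : ℕ} (hm : 2 ≤ m) (L : ℕ) (z : Fin n → ℝ × ℝ)
    (hz : ∀ i, z i ∈ Set.Icc (0:ℝ) 1 ×ˢ Set.Icc (0:ℝ) 1) {g : ℝ → ℝ → ℝ}
    (hg : ContDiff ℝ (m : ℕ∞) (fun q : ℝ × ℝ => g q.1 q.2)) :
    ∃ v ∈ VV m L z, nE (fun i => g (z i).1 (z i).2 - v i) ≤
      Real.sqrt n * 2 ^ m * (1 / 2) ^ (L * m) * Real.sqrt (Omega2M m g) := by
  obtain ⟨v, hv, h⟩ := approx hm L z hz hg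
  refine ⟨v, hv, ?_⟩
  unfold nE
  apply Real.sqrt_le_iff.2
  refine ⟨by positivity, ?_⟩
  have h4 : (0:ℝ) < 4 ^ (L * m) := by positivity
  have e1 : ((1 / 2 : ℝ) ^ (L * m)) ^ 2 = (4 ^ (L * m))⁻¹ := by
    rw [← pow_mul, mul_comm (L * m) 2, pow_mul, ← inv_pow]
    norm_num
  have e2 : ((2 : ℝ) ^ m) ^ 2 = 4 ^ m := by
    rw [← pow_mul, mul_comm m 2, pow_mul]
    norm_num
  rw [mul_pow, mul_pow, mul_pow, Real.sq_sqrt (Nat.cast_nonneg n),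
    Real.sq_sqrt (Omega2M_nonneg m g), e1, e2]
  rw [← le_div_iff₀ h4] at h
  refine h.trans (le_of_eq ?_)
  field_simp

lemma level {n p m : ℕ} (hm : 2 ≤ m) (hn : 1 ≤ n) (x : Fin n → Fin p → ℝ)
    (hx : ∀ i j, x i j ∈ Set.Icc (0:ℝ) 1) (J : Finset (Fin p × Fin p)) {M : ℕ} (hM : 1 ≤ M)
    (hJ : J.card ≤ M) (k : ℕ) :
    ∃ V : Submodule ℝ (Fin n → ℝ), Module.finrank ℝ V ≤ 9 * m ^ 2 * M * 4 ^ k ∧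
      ∀ R : AddRepM p m, SuppIn R J → ∃ v ∈ V, (n ≤ 4 ^ k → v = evalVecM x R) ∧
        nE (evalVecM x R - v) ≤ Real.sqrt n * 2 ^ m * (1 / 2) ^ (k * m) * OmegaTildeGrM R := by
  have hO : ∀ R : AddRepM p m, SuppIn R J → 0 ≤ OmegaTildeGrM R := by
    intro R hR
    rw [OmegaT_eq hR]
    exact Finset.sum_nonneg fun _ _ => Real.sqrt_nonneg _
  by_cases hk : n ≤ 4 ^ k
  · refine ⟨⊤, ?_, fun R hR => ⟨evalVecM x R, trivial, fun _ => rfl, ?_⟩⟩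
    · have h1 : 1 ≤ 9 * m ^ 2 * M := by
        have : 0 < 9 * m ^ 2 * M := by positivity
        omega
      rw [finrank_top, Module.finrank_fin_fun]
      nlinarith
    · have := hO R hR
      simp only [sub_self]
      have e : nE (0 : Fin n → ℝ) = 0 := by simp [nE]
      rw [e]
      positivity
  · obtain ⟨W, hWe⟩ : ∃ W : Fin p × Fin p → Submodule ℝ (Fin n → ℝ),
        ∀ q, W q = VV m k fun i => (x i q.1, x i q.2) := ⟨_, fun _ => rfl⟩
    refine ⟨J.sup W, ?_, fun R hR => ?_⟩
    · refine (finrank_sup_le _ _).trans ?_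
      calc _ ≤ ∑ q ∈ J, 9 * m ^ 2 * 4 ^ k := Finset.sum_le_sum fun q _ => by
            rw [hWe q]
            exact VV_finrank k _ hm hn
        _ = J.card * (9 * m ^ 2 * 4 ^ k) := by simp
        _ ≤ M * (9 * m ^ 2 * 4 ^ k) := by gcongr
        _ = _ := by ring
    · choose v hv hb using fun q : Fin p × Fin p =>
        approx_one hm k (fun i => (x i q.1, x i q.2)) (fun i => ⟨hx _ _, hx _ _⟩) (gq_smooth R q)
      simp only [← hWe] at hv
      refine ⟨∑ q ∈ J, v q, Submodule.sum_mem _ fun q hq => ?_, fun h => absurd h hk, ?_⟩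
      · exact mem_fsup J W hq (hv q)
      · have e : evalVecM x R - ∑ q ∈ J, v q =
            ∑ q ∈ J, fun i => gq R q (x i q.1) (x i q.2) - v q i := by
          ext i
          simp [evalVecM, toFun_eq hR, Finset.sum_sub_distrib]
        rw [e, OmegaT_eq hR, Finset.mul_sum]
        exact (nE_sum _ _).trans (Finset.sum_le_sum fun q _ => hb q)

lemma choose_L {m n : ℕ} (hn : 1 ≤ n) : ∃ L : ℕ,
    (2:ℝ) ^ L / Real.sqrt n ≤ 2 * rnM m n ∧ (1 / 2 : ℝ) ^ (L * m) ≤ rnM m n := by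
  have hn0 : (0:ℝ) < n := by exact_mod_cast hn
  have hn1 : (1:ℝ) ≤ n := by exact_mod_cast hn
  set y : ℝ := (n:ℝ) ^ (1 / ((m:ℝ) + 1)) with hy
  have hm1 : (0:ℝ) < (m:ℝ) + 1 := by positivity
  have hy1 : 1 ≤ y := Real.one_le_rpow hn1 (by positivity)
  have hy0 : 0 < y := by linarith
  have hρ : 0 < rnM m n := Real.rpow_pos_of_pos hn0 _
  have hny : (n:ℝ) = y ^ (m + 1) := by
    rw [hy, ← Real.rpow_natCast, ← Real.rpow_mul hn0.le]
    push_cast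
    rw [one_div_mul_cancel hm1.ne', Real.rpow_one]
  have hρy : rnM m n ^ 2 * y ^ m = 1 := by
    unfold rnM
    rw [hy, ← Real.rpow_natCast, ← Real.rpow_natCast, ← Real.rpow_mul hn0.le,
      ← Real.rpow_mul hn0.le, ← Real.rpow_add hn0]
    convert Real.rpow_zero (n:ℝ) using 2
    push_cast
    field_simp
    ring
  obtain ⟨l, h1, h2⟩ := exists_nat_pow_near hy1 (by norm_num : (1:ℝ) < 4)
  have e4 : ((2:ℝ) ^ (l + 1)) ^ 2 = 4 ^ (l + 1) := by
    rw [← pow_mul, mul_comm (l + 1) 2, pow_mul]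
    norm_num
  refine ⟨l + 1, ?_, ?_⟩
  · rw [div_le_iff₀ (by positivity)]
    apply le_of_sq_le_sq _ (by positivity)
    rw [mul_pow, mul_pow, Real.sq_sqrt hn0.le, e4]
    have : rnM m n ^ 2 * n = y := by
      calc rnM m n ^ 2 * n = rnM m n ^ 2 * y ^ (m + 1) := by rw [← hny]
        _ = (rnM m n ^ 2 * y ^ m) * y := by ring
        _ = y := by rw [hρy, one_mul]
    rw [pow_succ]
    nlinarith
  · apply le_of_sq_le_sq _ hρ.le
    have e : ((1 / 2 : ℝ) ^ ((l + 1) * m)) ^ 2 = ((4 ^ (l + 1)) ^ m)⁻¹ := by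
      rw [← e4, one_div, inv_pow, inv_pow, ← pow_mul, ← pow_mul, ← pow_mul]
      congr 2
      ring
    have e5 : rnM m n ^ 2 = (y ^ m)⁻¹ := eq_inv_of_mul_eq_one_left hρy
    rw [e, e5]
    gcongr

end Census
namespace Census

lemma coef_bound {n m : ℕ} (hn : 1 ≤ n) {A t : ℝ} (hA : 0 ≤ A) (ht : 0 < t) {L : ℕ}
    (hL : (2:ℝ) ^ L / Real.sqrt n ≤ 2 * rnM m n) (k : ℕ) :
    Real.sqrt (2 * (5 * A * 4 ^ (L + k)) + 4 * (t + k + 1)) ≤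
      Real.sqrt n * (2 ^ k * (2 * Real.sqrt (10 * A + 4) * rnM m n + 2 * Real.sqrt (t / n))) := by
  have hn0 : (0:ℝ) < n := by exact_mod_cast hn
  have hsn : 0 < Real.sqrt n := Real.sqrt_pos.2 hn0
  have hk : (k:ℝ) + 1 ≤ 4 ^ (L + k) := by
    have h1 : k + 1 ≤ 4 ^ (L + k) := by
      have := Nat.lt_pow_self (n := L + k) (by norm_num : 1 < 4)
      omega
    exact_mod_cast h1
  have e4 : ((2:ℝ) ^ (L + k)) ^ 2 = 4 ^ (L + k) := by
    rw [← pow_mul, mul_comm (L + k) 2, pow_mul]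
    norm_num
  have hB : 0 ≤ Real.sqrt (10 * A + 4) := Real.sqrt_nonneg _
  have h1 : Real.sqrt (2 * (5 * A * 4 ^ (L + k)) + 4 * (t + k + 1)) ≤
      Real.sqrt (10 * A + 4) * 2 ^ (L + k) + 2 * Real.sqrt t := by
    apply Real.sqrt_le_iff.2
    refine ⟨by positivity, ?_⟩
    have h2 : (Real.sqrt (10 * A + 4) * 2 ^ (L + k)) ^ 2 = (10 * A + 4) * 4 ^ (L + k) := by
      rw [mul_pow, e4, Real.sq_sqrt (by positivity)]
    have h3 : (2 * Real.sqrt t) ^ 2 = 4 * t := by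
      rw [mul_pow, Real.sq_sqrt ht.le]
      norm_num
    have h4 : 0 ≤ (Real.sqrt (10 * A + 4) * 2 ^ (L + k)) * (2 * Real.sqrt t) := by positivity
    nlinarith
  refine h1.trans ?_
  have h5 : (2:ℝ) ^ L ≤ Real.sqrt n * (2 * rnM m n) := by
    rw [div_le_iff₀ hsn] at hL
    linarith
  have h6 : Real.sqrt t = Real.sqrt n * Real.sqrt (t / n) := by
    rw [← Real.sqrt_mul hn0.le, mul_div_cancel₀ _ hn0.ne']
  have h7 : (1:ℝ) ≤ 2 ^ k := one_le_pow₀ (by norm_num)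
  have h8 : 0 ≤ Real.sqrt n * Real.sqrt (t / n) := by positivity
  calc Real.sqrt (10 * A + 4) * 2 ^ (L + k) + 2 * Real.sqrt t
      = Real.sqrt (10 * A + 4) * 2 ^ k * 2 ^ L + 2 * (Real.sqrt n * Real.sqrt (t / n)) := by
        rw [h6, pow_add]
        ring
    _ ≤ Real.sqrt (10 * A + 4) * 2 ^ k * (Real.sqrt n * (2 * rnM m n)) +
        2 ^ k * (2 * (Real.sqrt n * Real.sqrt (t / n))) := by
        apply add_le_add
        · gcongr
        · nlinarith
    _ = _ := by ring

lemma chain {n m N L : ℕ} (hm : 2 ≤ m) (hn : 1 ≤ n) (hN : 1 ≤ N) {G Om : ℝ}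
    (hG : 0 ≤ G) (hOm : 0 ≤ Om)
    (hL : (1 / 2 : ℝ) ^ (L * m) ≤ rnM m n) (w f : Fin n → ℝ) (v : ℕ → Fin n → ℝ)
    (hvN : v N = f)
    (hv : ∀ k, nE (f - v k) ≤ Real.sqrt n * 2 ^ m * (1 / 2) ^ ((L + k) * m) * Om)
    (h0 : ∑ i, w i * v 0 i ≤ Real.sqrt n * (2 ^ 0 * G) * nE (v 0))
    (hk : ∀ k < N, ∑ i, w i * (v (k + 1) - v k) i ≤
      Real.sqrt n * (2 ^ k * G) * nE (v (k + 1) - v k)) :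
    innerN w f ≤ G * (normN f + 5 * 2 ^ m * rnM m n * Om) := by
  have hn0 : (0:ℝ) < n := by exact_mod_cast hn
  have hsn : 0 < Real.sqrt n := Real.sqrt_pos.2 hn0
  have hρ : 0 < rnM m n := Real.rpow_pos_of_pos hn0 _
  have hv2 : ∀ k, nE (f - v k) ≤ Real.sqrt n * (2 ^ m * rnM m n * Om) * (1 / 4) ^ k := by
    intro k
    refine (hv k).trans ?_
    have h1 : (1 / 2 : ℝ) ^ (k * m) ≤ (1 / 4) ^ k := by
      rw [show (1 / 4 : ℝ) = (1 / 2) ^ 2 by norm_num, ← pow_mul]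
      apply pow_le_pow_of_le_one (by norm_num) (by norm_num)
      nlinarith
    rw [add_mul, pow_add]
    calc _ ≤ Real.sqrt n * 2 ^ m * (rnM m n * (1 / 4) ^ k) * Om := by gcongr
      _ = _ := by ring
  have hd : ∀ k, nE (v (k + 1) - v k) ≤
      2 * (Real.sqrt n * (2 ^ m * rnM m n * Om)) * (1 / 4) ^ k := by
    intro k
    have e : v (k + 1) - v k = (f - v k) + -(f - v (k + 1)) := by abel
    rw [e]
    refine (nE_add _ _).trans ?_
    rw [nE_neg]
    have a1 := hv2 k
    have a2 := hv2 (k + 1)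
    have a3 : Real.sqrt n * (2 ^ m * rnM m n * Om) * (1 / 4) ^ (k + 1) ≤
        Real.sqrt n * (2 ^ m * rnM m n * Om) * (1 / 4) ^ k := by
      apply mul_le_mul_of_nonneg_left _ (by positivity)
      exact pow_le_pow_of_le_one (by norm_num) (by norm_num) (by omega)
    linarith
  have h00 : nE (v 0) ≤ nE f + Real.sqrt n * (2 ^ m * rnM m n * Om) := by
    have e : v 0 = f + -(f - v 0) := by abel
    rw [e]
    refine (nE_add _ _).trans ?_
    rw [nE_neg]
    have := hv2 0
    simp only [pow_zero, mul_one] at this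
    linarith
  have hgeo : ∑ k ∈ Finset.range N, (1 / 2 : ℝ) ^ k ≤ 2 := by
    rw [geom_sum_eq (by norm_num)]
    have : (0:ℝ) ≤ (1 / 2) ^ N := by positivity
    rw [div_le_iff_of_neg (by norm_num)]
    linarith
  have htel : ∑ i, w i * f i = ∑ i, w i * v 0 i +
      ∑ k ∈ Finset.range N, ∑ i, w i * (v (k + 1) - v k) i := by
    rw [Finset.sum_comm, ← Finset.sum_add_distrib]
    refine Finset.sum_congr rfl fun i _ => ?_
    simp only [Pi.sub_apply]
    rw [← Finset.mul_sum, Finset.sum_range_sub (fun k => v k i), hvN]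
    ring
  have hsum : ∑ k ∈ Finset.range N, ∑ i, w i * (v (k + 1) - v k) i ≤
      n * G * (4 * (2 ^ m * rnM m n * Om)) := by
    calc _ ≤ ∑ k ∈ Finset.range N,
          (n * G * (2 * (2 ^ m * rnM m n * Om))) * (1 / 2 : ℝ) ^ k := by
          refine Finset.sum_le_sum fun k hkN => ?_
          refine (hk k (Finset.mem_range.1 hkN)).trans ?_
          calc _ ≤ Real.sqrt n * (2 ^ k * G) *
                (2 * (Real.sqrt n * (2 ^ m * rnM m n * Om)) * (1 / 4) ^ k) := by
                gcongr
                exact hd k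
            _ = (Real.sqrt n * Real.sqrt n) * G * (2 * (2 ^ m * rnM m n * Om)) *
                (2 ^ k * (1 / 4) ^ k) := by ring
            _ = _ := by
                rw [Real.mul_self_sqrt hn0.le, ← mul_pow]
                norm_num
      _ = (n * G * (2 * (2 ^ m * rnM m n * Om))) * ∑ k ∈ Finset.range N, (1 / 2 : ℝ) ^ k := by
          rw [Finset.mul_sum]
      _ ≤ (n * G * (2 * (2 ^ m * rnM m n * Om))) * 2 := by gcongr
      _ = _ := by ring
  have h000 : ∑ i, w i * v 0 i ≤ n * G * (normN f + 2 ^ m * rnM m n * Om) := by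
    refine h0.trans ?_
    have e : nE f = Real.sqrt n * normN f := by
      rw [normN_eq]
      field_simp
    rw [e] at h00
    calc _ ≤ Real.sqrt n * (2 ^ 0 * G) *
          (Real.sqrt n * normN f + Real.sqrt n * (2 ^ m * rnM m n * Om)) := by gcongr
      _ = (Real.sqrt n * Real.sqrt n) * G * (normN f + 2 ^ m * rnM m n * Om) := by ring
      _ = _ := by rw [Real.mul_self_sqrt hn0.le]
  unfold innerN
  rw [one_div_mul_eq_div, div_le_iff₀ hn0, htel]
  linarith

lemma exp_sum_le (N : ℕ) (t : ℝ) :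
    ∑ k ∈ Finset.range N, Real.exp (-(t + k + 1)) ≤ Real.exp (-t) := by
  have h : ∀ k : ℕ, Real.exp (-(t + k + 1)) ≤ Real.exp (-t) * ((1 / 2) * (1 / 2) ^ k) := by
    intro k
    have e : -(t + k + 1) = -t + ((k + 1 : ℕ) : ℝ) * (-1) := by
      push_cast
      ring
    rw [e, Real.exp_add, Real.exp_nat_mul, ← pow_succ']
    gcongr
    rw [Real.exp_neg, one_div]
    apply inv_anti₀ (by norm_num)
    have := Real.add_one_le_exp (1:ℝ)
    linarith
  refine (Finset.sum_le_sum fun k _ => h k).trans ?_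
  rw [← Finset.mul_sum, ← Finset.mul_sum, geom_sum_eq (by norm_num)]
  have h1 : (0:ℝ) ≤ (1 / 2) ^ N := by positivity
  have h2 : (1 / 2 : ℝ) * (((1 / 2) ^ N - 1) / (1 / 2 - 1)) ≤ 1 := by
    have : (1 / 2 : ℝ) * (((1 / 2) ^ N - 1) / (1 / 2 - 1)) = 1 - (1 / 2) ^ N := by ring
    linarith
  have := Real.exp_pos (-t)
  nlinarith

end Census

open Census in
/-- Lemma 2, maximal inequality over `F(J)`.  There is `C > 0`
depending only on `m` and `K` such that for every `J ⊆ 𝒥` with `|J| ≤ M = K(K+1)/2`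
and every `t > 0`, with probability at least `1 - e^{-t}` over the i.i.d. `N(0,σ²)`
noise `ε`, simultaneously for all `f ∈ F(J)`:
`(ε/σ, f)ₙ ≤ C[(rₙ + √(t/n))‖f‖ₙ + (rₙ² + rₙ√(t/n))Ω̃_gr(f)]`. -/
theorem statement6 (m K : ℕ) (hm : 2 ≤ m) (hK : 1 ≤ K) :
    ∃ C : ℝ, 0 < C ∧
      ∀ (n p : ℕ), 1 ≤ n → 1 ≤ p →
      ∀ (x : Fin n → Fin p → ℝ), (∀ i j, x i j ∈ Set.Icc (0:ℝ) 1) →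
      ∀ (σ : ℝ), 0 < σ →
      ∀ (J : Finset (Fin p × Fin p)), (∀ q ∈ J, q.1 ≤ q.2) →
        J.card ≤ K * (K + 1) / 2 →
      ∀ (t : ℝ), 0 < t →
        ENNReal.ofReal (1 - Real.exp (-t)) ≤
          gaussMeasure n σ
            {ε : Fin n → ℝ |
              ∀ R : AddRepM p m, SuppIn R J →
                innerN (fun i => ε i / σ) (evalVecM x R) ≤
                  C * ((rnM m n + Real.sqrt (t / n)) * normN (evalVecM x R)
                    + (rnM m n ^ 2 + rnM m n * Real.sqrt (t / n)) * OmegaTildeGrM R)} := by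
  set M := K * (K + 1) / 2 with hMdef
  have hM : 1 ≤ M := by
    rw [hMdef, Nat.le_div_iff_mul_le (by norm_num)]
    nlinarith
  set A : ℝ := ((9 * m ^ 2 * M : ℕ) : ℝ) with hA
  have hA0 : 0 ≤ A := Nat.cast_nonneg _
  set B : ℝ := Real.sqrt (10 * A + 4) with hB
  have hB0 : 0 ≤ B := Real.sqrt_nonneg _
  refine ⟨(2 * B + 2) * (1 + 5 * 2 ^ m), by positivity, ?_⟩
  intro n p hn hp x hx σ hσ J hJle hJ t ht
  have hn0 : (0:ℝ) < n := by exact_mod_cast hn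
  have hρ : 0 < rnM m n := Real.rpow_pos_of_pos hn0 _
  obtain ⟨L, hL1, hL2⟩ := choose_L (m := m) hn
  choose V hVr hVa using fun k => level hm hn x hx J hM hJ (L + k)
  have hW : ∀ k, (Module.finrank ℝ (V k ⊔ V (k + 1) : Submodule ℝ (Fin n → ℝ)) : ℝ) ≤
      5 * A * 4 ^ (L + k) := by
    intro k
    have h1 : Module.finrank ℝ (V k ⊔ V (k + 1) : Submodule ℝ (Fin n → ℝ)) ≤
        5 * (9 * m ^ 2 * M) * 4 ^ (L + k) := by
      refine (Submodule.finrank_add_le_finrank_add_finrank _ _).trans ?_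
      have h2 := hVr k
      have h3 := hVr (k + 1)
      refine (Nat.add_le_add h2 h3).trans (le_of_eq ?_)
      rw [← add_assoc, pow_succ]
      ring
    rw [hA]
    exact_mod_cast h1
  set bad : ℕ → Set (Fin n → ℝ) := fun k =>
    {ε | ¬ ∀ v ∈ V k ⊔ V (k + 1), ∑ i, (ε i / σ) * v i ≤
      Real.sqrt (2 * (5 * A * 4 ^ (L + k)) + 4 * (t + k + 1)) * Real.sqrt (∑ i, v i ^ 2)} with hbad
  have hbadm : ∀ k, gaussMeasure n σ (bad k) ≤ ENNReal.ofReal (Real.exp (-(t + k + 1))) :=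
    fun k => subspace_tail hσ (V k ⊔ V (k + 1)) (hW k) (by positivity)
  set S : Set (Fin n → ℝ) := {ε : Fin n → ℝ |
              ∀ R : AddRepM p m, SuppIn R J →
                innerN (fun i => ε i / σ) (evalVecM x R) ≤
                  (2 * B + 2) * (1 + 5 * 2 ^ m) *
                   ((rnM m n + Real.sqrt (t / n)) * normN (evalVecM x R)
                    + (rnM m n ^ 2 + rnM m n * Real.sqrt (t / n)) * OmegaTildeGrM R)} with hS
  have hsub : Sᶜ ⊆ ⋃ k ∈ Finset.range n, bad k := by
    intro ε hε
    by_contra hcon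
    apply hε
    have hgood : ∀ k < n, ∀ v ∈ V k ⊔ V (k + 1), ∑ i, (ε i / σ) * v i ≤
        Real.sqrt n * (2 ^ k * (2 * B * rnM m n + 2 * Real.sqrt (t / n))) * nE v := by
      intro k hk v hv
      have h1 : ε ∉ bad k := fun h => hcon (Set.mem_biUnion (Finset.mem_coe.2
        (Finset.mem_range.2 hk)) h)
      have h2 := not_not.1 h1 v hv
      refine h2.trans ?_
      exact mul_le_mul_of_nonneg_right (coef_bound hn hA0 ht hL1 k) (Real.sqrt_nonneg _)
    intro R hR
    have hOm : 0 ≤ OmegaTildeGrM R := by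
      rw [OmegaT_eq hR]
      exact Finset.sum_nonneg fun _ _ => Real.sqrt_nonneg _
    choose v hvV hvf hvb using fun k => hVa k R hR
    have hT : 0 ≤ Real.sqrt (t / n) := Real.sqrt_nonneg _
    have hend : n ≤ 4 ^ (L + n) := by
      have := Nat.lt_pow_self (n := L + n) (by norm_num : 1 < 4)
      omega
    have hc := chain (N := n) (L := L) (G := 2 * B * rnM m n + 2 * Real.sqrt (t / n)) hm hn hn
      (by positivity) hOm hL2 (fun i => ε i / σ) (evalVecM x R) v (hvf n hend) hvb
      (hgood 0 (by omega) _ (Submodule.mem_sup_left (hvV 0)))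
      (fun k hk => hgood k hk _ (Submodule.sub_mem _ (Submodule.mem_sup_right (hvV (k + 1)))
        (Submodule.mem_sup_left (hvV k))))
    refine hc.trans ?_
    have hN0 : 0 ≤ normN (evalVecM x R) := Real.sqrt_nonneg _
    have h2m : (0:ℝ) ≤ 5 * 2 ^ m := by positivity
    have g1 : 2 * B * rnM m n + 2 * Real.sqrt (t / n) ≤
        (2 * B + 2) * (rnM m n + Real.sqrt (t / n)) := by
      nlinarith [mul_nonneg hB0 hT]
    have g2 : normN (evalVecM x R) + 5 * 2 ^ m * rnM m n * OmegaTildeGrM R ≤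
        (1 + 5 * 2 ^ m) * (normN (evalVecM x R) + rnM m n * OmegaTildeGrM R) := by
      nlinarith [mul_nonneg h2m hN0, mul_nonneg hρ.le hOm]
    calc _ ≤ ((2 * B + 2) * (rnM m n + Real.sqrt (t / n))) *
          ((1 + 5 * 2 ^ m) * (normN (evalVecM x R) + rnM m n * OmegaTildeGrM R)) := by
          apply mul_le_mul g1 g2 <;> positivity
      _ = _ := by ring
  have hSc : gaussMeasure n σ Sᶜ ≤ ENNReal.ofReal (Real.exp (-t)) := by
    refine (measure_mono hsub).trans ((measure_biUnion_finset_le _ _).trans ?_)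
    refine (Finset.sum_le_sum fun k _ => hbadm k).trans ?_
    rw [← ENNReal.ofReal_sum_of_nonneg (fun _ _ => (Real.exp_pos _).le)]
    exact ENNReal.ofReal_le_ofReal (exp_sum_le n t)
  have hone : 1 ≤ gaussMeasure n σ S + gaussMeasure n σ Sᶜ := by
    rw [← measure_univ (μ := gaussMeasure n σ), ← Set.union_compl_self S]
    exact measure_union_le _ _
  rw [ENNReal.ofReal_sub _ (Real.exp_pos _).le, ENNReal.ofReal_one]
  exact tsub_le_iff_right.2 (hone.trans (by gcongr))
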